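/- arXiv:1807.05883 — 3 statements merged into one kernel-verified Lean document; each statement's English description precedes it below -/
import Mathlib

section
/- Let r ≥ 0 be an integer. Suppose (p₀,p₁,p₂,p₃) is a piecewise polynomial vector field of degree ≤ r on the Alfeld split T^z of a tetrahedron T ⊂ ℝ³ such that: (i) its tangential components are single-valued across interior faces, i.e. (p_i − p_j) × n_{ij} = 0 at every point of F_{ij} for all i ≠ j; (ii) its tangential trace vanishes on the boundary, i.e. p_i × n_i = 0 at every point of the boundary face F_i for each i; and (iii) curl p_i = 0 identically for each i. Then there exists a piecewise polynomial scalar field (q₀,q₁,q₂,q₃) of degree ≤ r+1 on T^z which is continuous across interior faces (q_i = q_j on F_{ij} for all i ≠ j), vanishes on the boundary of T (q_i = 0 on F_i for each i), and satisfies grad q_i = p_i for each i. -/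
open MvPolynomial Matrix

noncomputable section

namespace Alfeld

abbrev V3 : Type := Fin 3 → ℝ
abbrev P3 : Type := MvPolynomial (Fin 3) ℝ
abbrev VP3 : Type := Fin 3 → P3

/-- Cross product of vectors in `ℝ³`. -/
def cross3 (u v : V3) : V3 := fun c => u (c + 1) * v (c + 2) - u (c + 2) * v (c + 1)

/-- Evaluation of a polynomial vector field at a point. -/
def evalV (p : VP3) (y : V3) : V3 := fun c => eval y (p c)

/-- Gradient of a polynomial. -/
def pgrad (q : P3) : VP3 := fun c => pderiv c q

/-- Curl of a polynomial vector field. -/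
def pcurl (p : VP3) : VP3 := fun c => pderiv (c + 1) (p (c + 2)) - pderiv (c + 2) (p (c + 1))

/-- Divergence of a polynomial vector field. -/
def pdiv (p : VP3) : P3 := ∑ c, pderiv c (p c)

/-- Cross product of polynomial vector fields. -/
def pcross (u v : VP3) : VP3 := fun c => u (c + 1) * v (c + 2) - u (c + 2) * v (c + 1)

/-- All components have total degree at most `r`. -/
def degVle (p : VP3) (r : ℕ) : Prop := ∀ c, (p c).totalDegree ≤ r

/-- Barycenter of the tetrahedron with vertices `x 0, x 1, x 2, x 3`. -/
def bary (x : Fin 4 → V3) : V3 := (4 : ℝ)⁻¹ • (x 0 + x 1 + x 2 + x 3)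

/-- The piece `T_i` of the Alfeld split. -/
def piece (x : Fin 4 → V3) (i : Fin 4) : Set V3 :=
  convexHull ℝ (insert (bary x) (x '' {j | j ≠ i}))

/-- The interior face `F_{ij} = T_i ∩ T_j`. -/
def intFace (x : Fin 4 → V3) (i j : Fin 4) : Set V3 :=
  convexHull ℝ (insert (bary x) (x '' {k | k ≠ i ∧ k ≠ j}))

/-- The boundary face of `T` opposite the vertex `x i`. -/
def bdryFace (x : Fin 4 → V3) (i : Fin 4) : Set V3 :=
  convexHull ℝ (x '' {j | j ≠ i})

/-- `n` is a (Euclidean) unit normal of the interior face `F_{ij}`. -/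
def IsUnitNormalInt (x : Fin 4 → V3) (i j : Fin 4) (n : V3) : Prop :=
  n ⬝ᵥ n = 1 ∧ ∀ k, k ≠ i → k ≠ j → n ⬝ᵥ (x k - bary x) = 0

/-- `n` is a (Euclidean) unit normal of the boundary face `F_i`. -/
def IsUnitNormalBdry (x : Fin 4 → V3) (i : Fin 4) (n : V3) : Prop :=
  n ⬝ᵥ n = 1 ∧ ∀ j k, j ≠ i → k ≠ i → n ⬝ᵥ (x k - x j) = 0

/-- The vertices of the Alfeld split. -/
def vertices (x : Fin 4 → V3) : Set V3 := insert (bary x) (Set.range x)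

/-- Jacobian matrix of a polynomial vector field at a point. -/
def jacob (p : VP3) (a : V3) : Fin 3 → Fin 3 → ℝ := fun c d => eval a (pderiv d (p c))

end Alfeld

open Alfeld

namespace Alfeld

/-- Divide the degree `n` homogeneous part of a polynomial by `n + 1`. -/
def divDegreeSucc (f : P3) : P3 :=
  ∑ m ∈ f.support, monomial m (coeff m f / ((m.degree : ℝ) + 1))

theorem coeff_divDegreeSucc (f : P3) (m : Fin 3 →₀ ℕ) :
    coeff m (divDegreeSucc f) = coeff m f / ((m.degree : ℝ) + 1) := by
  classical
  simp only [divDegreeSucc, coeff_sum, coeff_monomial, Finset.sum_ite_eq']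
  split_ifs with h
  · rfl
  · rw [notMem_support_iff.mp h, zero_div]

theorem totalDegree_divDegreeSucc_le (f : P3) :
    (divDegreeSucc f).totalDegree ≤ f.totalDegree := by
  refine totalDegree_le_of_support_subset fun m hm => ?_
  rw [mem_support_iff, coeff_divDegreeSucc] at hm
  rw [mem_support_iff]
  rintro h
  simp [h] at hm

theorem pderiv_divDegreeSucc_comm {f g : P3} {c d : Fin 3} (h : pderiv d f = pderiv c g) :
    pderiv d (divDegreeSucc f) = pderiv c (divDegreeSucc g) := by
  ext m
  have hm := congrArg (coeff m) h
  simp only [coeff_pderiv] at hm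
  simp only [coeff_pderiv, coeff_divDegreeSucc, map_add, Finsupp.degree_single]
  rw [div_mul_eq_mul_div, div_mul_eq_mul_div, hm]

theorem coeff_X_mul_pderiv (f : P3) (c : Fin 3) (m : Fin 3 →₀ ℕ) :
    coeff m (X c * pderiv c f) = m c * coeff m f := by
  classical
  induction f using MvPolynomial.induction_on' with
  | add p q hp hq => simp [mul_add, hp, hq]
  | monomial n a =>
    rw [X_mul_pderiv_monomial, coeff_smul, coeff_monomial, nsmul_eq_mul]
    split_ifs with h
    · rw [h]
    · simp

theorem divDegreeSucc_add_euler (f : P3) :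
    divDegreeSucc f + ∑ c, X c * pderiv c (divDegreeSucc f) = f := by
  ext m
  simp only [coeff_add, coeff_sum, coeff_X_mul_pderiv, coeff_divDegreeSucc]
  rw [← Finset.sum_mul, ← Nat.cast_sum, ← Finsupp.degree_eq_sum]
  field_simp
  ring

/-- A curl-free polynomial field has symmetric Jacobian. -/
theorem pderiv_comm_of_pcurl_eq_zero {p : VP3} (h : pcurl p = 0) (c d : Fin 3) :
    pderiv d (p c) = pderiv c (p d) := by
  have h0 : pderiv 1 (p 2) = pderiv 2 (p 1) := sub_eq_zero.mp (congrFun h 0)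
  have h1 : pderiv 2 (p 0) = pderiv 0 (p 2) := sub_eq_zero.mp (congrFun h 1)
  have h2 : pderiv 0 (p 1) = pderiv 1 (p 0) := sub_eq_zero.mp (congrFun h 2)
  match c, d with
  | 0, 0 | 1, 1 | 2, 2 => rfl
  | 0, 1 => exact h2.symm
  | 1, 0 => exact h2
  | 0, 2 => exact h1
  | 2, 0 => exact h1.symm
  | 1, 2 => exact h0.symm
  | 2, 1 => exact h0

/-- Polynomial Poincaré lemma with a degree bound. -/
theorem exists_potential {p : VP3} {r : ℕ} (hdeg : degVle p r) (h : pcurl p = 0) :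
    ∃ q : P3, q.totalDegree ≤ r + 1 ∧ pgrad q = p := by
  classical
  refine ⟨∑ c, X c * divDegreeSucc (p c), ?_, ?_⟩
  · refine totalDegree_finsetSum_le fun c _ => (totalDegree_mul _ _).trans ?_
    rw [totalDegree_X, add_comm]
    gcongr
    exact (totalDegree_divDegreeSucc_le _).trans (hdeg c)
  · funext d
    rw [pgrad, map_sum]
    conv_rhs => rw [← divDegreeSucc_add_euler (p d)]
    simp only [pderiv_mul, Finset.sum_add_distrib]
    congr 1
    · rw [Finset.sum_eq_single d]
      · simp
      · intro b _ hb
        simp [pderiv_X_of_ne hb]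
      · simp
    · exact Finset.sum_congr rfl fun c _ => by
        rw [pderiv_divDegreeSucc_comm (pderiv_comm_of_pcurl_eq_zero h c d)]

theorem hasDerivAt_eval_line (q : P3) (a v : V3) (t : ℝ) :
    HasDerivAt (fun s : ℝ => eval (a + s • v) q) (evalV (pgrad q) (a + t • v) ⬝ᵥ v) t := by
  classical
  induction q using MvPolynomial.induction_on with
  | C b => simpa [evalV, pgrad, dotProduct] using hasDerivAt_const t b
  | add f g hf hg =>
    have := hf.add hg
    simp only [evalV, pgrad, dotProduct, map_add, add_mul, Finset.sum_add_distrib] at this ⊢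
    exact this
  | mul_X f c hf =>
    have hX : HasDerivAt (fun s : ℝ => eval (a + s • v) (X c : P3)) (v c) t := by
      simpa using ((hasDerivAt_id t).mul_const (v c)).const_add (a c)
    refine HasDerivAt.congr_deriv (by simpa only [map_mul] using hf.fun_mul hX) ?_
    simp only [evalV, pgrad, dotProduct, map_mul, pderiv_mul, map_add, add_mul,
      Finset.sum_add_distrib, Finset.sum_mul]
    congr 1
    · exact Finset.sum_congr rfl fun d _ => by ring
    · rw [Finset.sum_eq_single c]
      · simp
      · intro d _ hd
        simp [pderiv_X_of_ne hd.symm]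
      · simp

/-- A polynomial whose gradient is orthogonal to `b - a` on a convex set containing `a` and `b`
takes equal values at `a` and `b`. -/
theorem eval_eq_of_grad_orthogonal {q : P3} {S : Set V3} (hS : Convex ℝ S) {a b : V3}
    (ha : a ∈ S) (hb : b ∈ S) (h : ∀ y ∈ S, evalV (pgrad q) y ⬝ᵥ (b - a) = 0) :
    eval b q = eval a q := by
  have key := constant_of_has_deriv_right_zero (a := (0 : ℝ)) (b := 1)
    (f := fun s : ℝ => eval (a + s • (b - a)) q)
    (fun t _ => (hasDerivAt_eval_line q a (b - a) t).continuousAt.continuousWithinAt)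
    (fun t ht => by
      have := hasDerivAt_eval_line q a (b - a) t
      rw [h _ (hS.add_smul_sub_mem ha hb ⟨ht.1, ht.2.le⟩)] at this
      exact this.hasDerivWithinAt) 1 (by simp)
  simpa using key

theorem exists_unit_orthogonal (u v : V3) : ∃ n : V3, n ⬝ᵥ n = 1 ∧ n ⬝ᵥ u = 0 ∧ n ⬝ᵥ v = 0 := by
  obtain ⟨w, hw, hwM⟩ := (exists_mulVec_eq_zero_iff
    (M := !![u 0, u 1, u 2; v 0, v 1, v 2; 0, 0, 0])).mpr
    (by simp [det_fin_three])
  have hu := congrFun hwM 0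
  have hv := congrFun hwM 1
  simp only [mulVec, dotProduct, Fin.sum_univ_three, of_apply, cons_val, Pi.zero_apply] at hu hv
  have hpos : 0 < w ⬝ᵥ w := by
    simpa using dotProduct_star_self_pos_iff.mpr hw
  refine ⟨(√(w ⬝ᵥ w))⁻¹ • w, ?_, ?_, ?_⟩
  · rw [smul_dotProduct, dotProduct_smul, smul_eq_mul, smul_eq_mul, ← mul_assoc, ← mul_inv,
      Real.mul_self_sqrt hpos.le, inv_mul_cancel₀ hpos.ne']
  · rw [smul_dotProduct, smul_eq_zero]
    right
    simp only [dotProduct, Fin.sum_univ_three]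
    linarith
  · rw [smul_dotProduct, smul_eq_zero]
    right
    simp only [dotProduct, Fin.sum_univ_three]
    linarith

/-- If `w × n = 0` with `n` a unit vector, then `w` is orthogonal to every vector orthogonal to `n`. -/
theorem dotProduct_eq_zero_of_cross3_eq_zero {w n v : V3} (hn : n ⬝ᵥ n = 1)
    (hw : cross3 w n = 0) (hv : n ⬝ᵥ v = 0) : w ⬝ᵥ v = 0 := by
  have h0 : w 1 * n 2 - w 2 * n 1 = 0 := congrFun hw 0
  have h1 : w 2 * n 0 - w 0 * n 2 = 0 := congrFun hw 1
  have h2 : w 0 * n 1 - w 1 * n 0 = 0 := congrFun hw 2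
  simp only [dotProduct, Fin.sum_univ_three] at *
  linear_combination (- (w 0 * v 0 + w 1 * v 1 + w 2 * v 2)) * hn
    + (w 0 * n 0 + w 1 * n 1 + w 2 * n 2) * hv
    - (n 1 * v 2 - n 2 * v 1) * h0 - (n 2 * v 0 - n 0 * v 2) * h1
    - (n 0 * v 1 - n 1 * v 0) * h2

/-- Orthogonality to a direction extends from a set to its convex hull. -/
theorem dotProduct_sub_eq_zero_of_mem_convexHull {n b : V3} {s : Set V3}
    (h : ∀ y ∈ s, n ⬝ᵥ (y - b) = 0) {y : V3} (hy : y ∈ convexHull ℝ s) : n ⬝ᵥ (y - b) = 0 := by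
  have hc : Convex ℝ {y : V3 | n ⬝ᵥ y = n ⬝ᵥ b} :=
    convex_hyperplane ⟨fun u v => dotProduct_add n u v, fun c u => dotProduct_smul c n u⟩ _
  have := convexHull_min (fun z hz => by
    have := h z hz
    rwa [dotProduct_sub, sub_eq_zero] at this) hc hy
  rw [dotProduct_sub, sub_eq_zero]
  exact this

theorem eval_const_on_convexHull {q : P3} {s : Set V3} {n b : V3} (hn : n ⬝ᵥ n = 1)
    (hs : ∀ y ∈ s, n ⬝ᵥ (y - b) = 0)
    (hq : ∀ y ∈ convexHull ℝ s, cross3 (evalV (pgrad q) y) n = 0)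
    {y z : V3} (hy : y ∈ convexHull ℝ s) (hz : z ∈ convexHull ℝ s) : eval y q = eval z q := by
  refine eval_eq_of_grad_orthogonal (convex_convexHull ℝ s) hz hy fun w hw =>
    dotProduct_eq_zero_of_cross3_eq_zero hn (hq w hw) ?_
  rw [← sub_sub_sub_cancel_right y z b, dotProduct_sub,
    dotProduct_sub_eq_zero_of_mem_convexHull hs hy,
    dotProduct_sub_eq_zero_of_mem_convexHull hs hz, sub_zero]

theorem exists_isUnitNormalBdry (x : Fin 4 → V3) (i : Fin 4) : ∃ n, IsUnitNormalBdry x i n := by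
  obtain ⟨a, b, c, h⟩ : ∃ a b c : Fin 4, ∀ k, k ≠ i → k = a ∨ k = b ∨ k = c := by
    revert i; decide
  obtain ⟨n, hn, hb, hc⟩ := exists_unit_orthogonal (x b - x a) (x c - x a)
  have key : ∀ k, k ≠ i → n ⬝ᵥ x k = n ⬝ᵥ x a := by
    rw [dotProduct_sub, sub_eq_zero] at hb hc
    intro k hk
    rcases h k hk with rfl | rfl | rfl
    exacts [rfl, hb, hc]
  exact ⟨n, hn, fun j k hj hk => by rw [dotProduct_sub, key j hj, key k hk, sub_self]⟩

theorem exists_isUnitNormalInt (x : Fin 4 → V3) {i j : Fin 4} (hij : i ≠ j) :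
    ∃ n, IsUnitNormalInt x i j n := by
  obtain ⟨a, b, h⟩ : ∃ a b : Fin 4, ∀ k, k ≠ i → k ≠ j → k = a ∨ k = b := by
    revert i j; decide
  obtain ⟨n, hn, ha, hb⟩ := exists_unit_orthogonal (x a - bary x) (x b - bary x)
  refine ⟨n, hn, fun k hi hj => ?_⟩
  rcases h k hi hj with rfl | rfl
  exacts [ha, hb]

end Alfeld


/-- curl-free piecewise polynomial vector fields on an Alfeld split with
single-valued tangential traces on interior faces and vanishing tangential trace on the
boundary are gradients of continuous piecewise polynomials vanishing on the boundary. -/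
theorem statement0 (r : ℕ) (x : Fin 4 → V3) (hx : AffineIndependent ℝ x)
    (p : Fin 4 → VP3) (hdeg : ∀ i, degVle (p i) r)
    (htangInt : ∀ i j, i ≠ j → ∀ n, IsUnitNormalInt x i j n →
      ∀ y ∈ intFace x i j, cross3 (evalV (p i) y - evalV (p j) y) n = 0)
    (htangBdry : ∀ i, ∀ n, IsUnitNormalBdry x i n →
      ∀ y ∈ bdryFace x i, cross3 (evalV (p i) y) n = 0)
    (hcurl : ∀ i, pcurl (p i) = 0) :
    ∃ q : Fin 4 → P3,
      (∀ i, (q i).totalDegree ≤ r + 1) ∧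
      (∀ i j, i ≠ j → ∀ y ∈ intFace x i j, eval y (q i) = eval y (q j)) ∧
      (∀ i, ∀ y ∈ bdryFace x i, eval y (q i) = 0) ∧
      (∀ i, pgrad (q i) = p i) := by
  choose φ hφdeg hφ using fun i => exists_potential (hdeg i) (hcurl i)
  have hsucc : ∀ i : Fin 4, i + 1 ≠ i := by decide
  have hbdry : ∀ i, ∀ y ∈ bdryFace x i, eval y (φ i) = eval (x (i + 1)) (φ i) := by
    intro i y hy
    obtain ⟨n, hn⟩ := exists_isUnitNormalBdry x i
    refine eval_const_on_convexHull (b := x (i + 1)) hn.1 ?_ (fun z hz => ?_) hy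
      (subset_convexHull ℝ _ ⟨i + 1, hsucc i, rfl⟩)
    · rintro _ ⟨k, hk, rfl⟩
      exact hn.2 _ _ (hsucc i) hk
    · rw [hφ i]
      exact htangBdry i n hn z hz
  obtain ⟨q, hqdef⟩ : ∃ q : Fin 4 → P3, ∀ i, q i = φ i - C (eval (x (i + 1)) (φ i)) :=
    ⟨_, fun _ => rfl⟩
  have hq0 : ∀ i, ∀ y ∈ bdryFace x i, eval y (q i) = 0 := fun i y hy => by
    simp [hqdef, hbdry i y hy]
  have hqgrad : ∀ i, pgrad (q i) = p i := fun i => by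
    rw [← hφ i]
    funext c
    simp [hqdef, pgrad]
  refine ⟨q, fun i => hqdef i ▸ (totalDegree_sub_C_le _ _).trans (hφdeg i), ?_, hq0, hqgrad⟩
  intro i j hij y hy
  obtain ⟨n, hn⟩ := exists_isUnitNormalInt x hij
  obtain ⟨k, hki, hkj⟩ : ∃ k : Fin 4, k ≠ i ∧ k ≠ j := by
    clear hy hn
    revert i j
    decide
  have hconst : eval y (q i - q j) = eval (x k) (q i - q j) := by
    refine eval_const_on_convexHull (b := bary x) hn.1 ?_ (fun z hz => ?_) hy
      (subset_convexHull ℝ _ (Or.inr ⟨k, ⟨hki, hkj⟩, rfl⟩))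
    · rintro _ (rfl | ⟨l, hl, rfl⟩)
      · simp
      · exact hn.2 l hl.1 hl.2
    · have hgrad : evalV (pgrad (q i - q j)) z = evalV (p i) z - evalV (p j) z := by
        rw [← hqgrad i, ← hqgrad j]
        funext c
        simp [evalV, pgrad]
      rw [hgrad]
      exact htangInt i j hij n hn z hz
  rw [map_sub, map_sub, hq0 i _ (subset_convexHull ℝ _ ⟨k, hki, rfl⟩),
    hq0 j _ (subset_convexHull ℝ _ ⟨k, hkj, rfl⟩), sub_self, sub_eq_zero] at hconst
  exact hconst
end
end

section
/- Let r ≥ 0 be an integer. Suppose (p₀,p₁,p₂,p₃) is a piecewise polynomial vector field of degree ≤ r on the Alfeld split T^z of a tetrahedron T ⊂ ℝ³ such that: (i) its normal component is single-valued across interior faces, i.e. (p_i − p_j) · n_{ij} = 0 at every point of F_{ij} for all i ≠ j; (ii) its normal trace vanishes on the boundary, i.e. p_i · n_i = 0 at every point of the boundary face F_i for each i; and (iii) div p_i = 0 identically for each i. Then there exists a piecewise polynomial vector field (q₀,q₁,q₂,q₃) of degree ≤ r+1 on T^z which is continuous across interior faces (q_i = q_j on F_{ij} for all i ≠ j), vanishes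 on the boundary of T (q_i = 0 on F_i for each i), and satisfies curl q_i = p_i for each i. -/
open MvPolynomial Matrix

noncomputable section

open Alfeld

namespace Alfeld

/-! ### Affine polynomials and the planes they cut out -/

/-- The affine polynomial with gradient `a` and constant term `c`. -/
def affPoly (a : V3) (c : ℝ) : P3 := C c + ∑ d, C (a d) * X d

lemma eval_affPoly (a : V3) (c : ℝ) (y : V3) : eval y (affPoly a c) = c + ∑ d, a d * y d := by
  simp [affPoly]

lemma affPoly_sub (a b : V3) (c d : ℝ) :
    affPoly a c - affPoly b d = affPoly (a - b) (c - d) := by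
  simp [affPoly, Fin.sum_univ_three]
  ring

lemma pderiv_affPoly (a : V3) (c : ℝ) (d : Fin 3) : pderiv d (affPoly a c) = C (a d) := by
  simp [affPoly, pderiv_X, Pi.single_apply]

lemma totalDegree_affPoly_le (a : V3) (c : ℝ) : (affPoly a c).totalDegree ≤ 1 := by
  refine (totalDegree_add _ _).trans (max_le (by simp) ?_)
  refine totalDegree_finsetSum_le fun d _ => (totalDegree_mul _ _).trans ?_
  simp

lemma totalDegree_affPoly {a : V3} (ha : a ≠ 0) (c : ℝ) : (affPoly a c).totalDegree = 1 := by
  refine le_antisymm (totalDegree_affPoly_le a c) (Nat.one_le_iff_ne_zero.2 fun h => ha ?_)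
  funext d
  have h1 := pderiv_affPoly a c d
  rw [totalDegree_eq_zero_iff_eq_C.1 h, pderiv_C] at h1
  exact (C_eq_zero.1 h1.symm)

lemma affPoly_ne_zero {a : V3} (ha : a ≠ 0) (c : ℝ) : affPoly a c ≠ 0 := fun h => by
  simpa [h] using totalDegree_affPoly ha c

lemma eval_aeval {σ τ : Type*} (y : τ → ℝ) (u : σ → MvPolynomial τ ℝ) (F : MvPolynomial σ ℝ) :
    eval y (aeval u F) = eval (fun k => eval y (u k)) F := by
  induction F using MvPolynomial.induction_on with
  | C r => simp
  | add p q hp hq => rw [map_add, map_add, map_add, hp, hq]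
  | mul_X p k hp => rw [map_mul, map_mul, map_mul, hp, aeval_X, eval_X]

/-- Substituting congruent arguments into a polynomial gives congruent results. -/
lemma dvd_aeval_sub_aeval {σ R A : Type*} [CommRing R] [CommRing A] [Algebra R A] {l : A}
    {u v : σ → A} (h : ∀ k, l ∣ u k - v k) (F : MvPolynomial σ R) :
    l ∣ aeval u F - aeval v F := by
  rw [← Ideal.mem_span_singleton, ← Ideal.Quotient.eq]
  have huv : (fun k => Ideal.Quotient.mkₐ R (Ideal.span {l}) (u k)) =
      fun k => Ideal.Quotient.mkₐ R (Ideal.span {l}) (v k) := by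
    funext k
    exact Ideal.Quotient.eq.2 (Ideal.mem_span_singleton.2 (h k))
  have := congrArg (fun w => aeval w F) huv
  simp only [← comp_aeval_apply] at this
  exact this

/-- The projection of polynomials onto those constant in the direction `t`, which is the pullback
along an affine projection onto the plane `affPoly a c = 0` when `a ⬝ᵥ t = 1`. -/
def planeProj (a : V3) (c : ℝ) (t : V3) : P3 →ₐ[ℝ] P3 :=
  aeval fun d => X d - C (t d) * affPoly a c

lemma dvd_sub_planeProj (a : V3) (c : ℝ) (t : V3) (f : P3) :
    affPoly a c ∣ f - planeProj a c t f := by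
  have := dvd_aeval_sub_aeval (R := ℝ) (l := affPoly a c) (u := X)
    (v := fun d => X d - C (t d) * affPoly a c) (fun k => ⟨C (t k), by ring⟩) f
  simpa [planeProj] using this

lemma planeProj_affPoly {a : V3} (c : ℝ) {t : V3} (ht : a ⬝ᵥ t = 1) :
    planeProj a c t (affPoly a c) = 0 := by
  have h1 : (C (a 0) * C (t 0) + C (a 1) * C (t 1) + C (a 2) * C (t 2) : P3) = 1 := by
    simp only [← C_mul, ← C_add, ← C_1]
    congr 1
    simpa [dotProduct, Fin.sum_univ_three] using ht
  have h2 : planeProj a c t (affPoly a c) = affPoly a c -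
      (C (a 0) * C (t 0) + C (a 1) * C (t 1) + C (a 2) * C (t 2)) * affPoly a c := by
    conv_lhs => rw [affPoly]
    simp only [planeProj, map_add, map_mul, aeval_X, Fin.sum_univ_three, algHom_C,
      algebraMap_eq]
    conv_rhs => enter [1]; rw [affPoly]
    simp only [Fin.sum_univ_three]
    ring
  rw [h2, h1]; ring

lemma affPoly_dvd_iff_planeProj {a : V3} (c : ℝ) {t : V3} (ht : a ⬝ᵥ t = 1) (f : P3) :
    affPoly a c ∣ f ↔ planeProj a c t f = 0 := by
  constructor
  · rintro ⟨g, rfl⟩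
    rw [map_mul, planeProj_affPoly c ht, zero_mul]
  · intro h
    simpa [h] using dvd_sub_planeProj a c t f

lemma exists_dotProduct_eq_one {a : V3} (ha : a ≠ 0) : ∃ t, a ⬝ᵥ t = 1 :=
  ⟨(a ⬝ᵥ a)⁻¹ • a, by
    rw [dotProduct_smul, smul_eq_mul, inv_mul_cancel₀ (dotProduct_self_eq_zero.not.2 ha)]⟩

lemma affPoly_dvd_mul {a : V3} (ha : a ≠ 0) {c : ℝ} {f g : P3} (h : affPoly a c ∣ f * g) :
    affPoly a c ∣ f ∨ affPoly a c ∣ g := by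
  obtain ⟨t, ht⟩ := exists_dotProduct_eq_one ha
  simpa [affPoly_dvd_iff_planeProj c ht] using h

lemma affPoly_dvd_of_eval {a : V3} (ha : a ≠ 0) {c : ℝ} {f : P3}
    (h : ∀ y, eval y (affPoly a c) = 0 → eval y f = 0) : affPoly a c ∣ f := by
  obtain ⟨t, ht⟩ := exists_dotProduct_eq_one ha
  rw [affPoly_dvd_iff_planeProj c ht]
  refine MvPolynomial.funext fun y => ?_
  rw [planeProj, eval_aeval, map_zero]
  apply h
  rw [← eval_aeval, ← planeProj, planeProj_affPoly c ht, map_zero]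

lemma eval_eq_zero_of_dvd {σ : Type*} {l f : MvPolynomial σ ℝ} (h : l ∣ f) {y : σ → ℝ}
    (hy : eval y l = 0) : eval y f = 0 := by
  obtain ⟨g, rfl⟩ := h
  rw [map_mul, hy, zero_mul]

/-! ### Vector calculus for polynomial fields -/

lemma pderiv_pderiv_comm {σ : Type*} (i j : σ) (f : MvPolynomial σ ℝ) :
    pderiv i (pderiv j f) = pderiv j (pderiv i f) := by
  classical
  ext m
  simp only [coeff_pderiv, Finsupp.add_apply, add_right_comm m]
  rcases eq_or_ne i j with rfl | h
  · rfl
  · simp [h, h.symm]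
    ring

lemma totalDegree_pderiv_le {σ : Type*} (i : σ) (f : MvPolynomial σ ℝ) :
    (pderiv i f).totalDegree ≤ f.totalDegree - 1 := by
  classical
  refine Finset.sup_le fun m hm => ?_
  rw [mem_support_iff, coeff_pderiv] at hm
  have := le_totalDegree (mem_support_iff.2 (left_ne_zero_of_mul hm))
  rw [Finsupp.sum_add_index' (fun _ => rfl) (fun _ _ _ => rfl), Finsupp.sum_single_index rfl]
    at this
  omega

lemma pdiv_pcurl (u : VP3) : pdiv (pcurl u) = 0 := by
  simp only [pdiv, pcurl, Fin.sum_univ_three, map_sub]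
  simp only [Fin.isValue, Fin.reduceAdd, zero_add]
  rw [pderiv_pderiv_comm 1 0, pderiv_pderiv_comm 2 0, pderiv_pderiv_comm 2 1]
  ring

lemma pdiv_sub (u v : VP3) : pdiv (u - v) = pdiv u - pdiv v := by
  simp [pdiv]

lemma pdiv_mul (f : P3) (v : VP3) :
    pdiv (fun c => f * v c) = f * pdiv v + ∑ c, v c * pderiv c f := by
  simp [pdiv, Fin.sum_univ_three]
  ring

lemma pcurl_add (u v : VP3) : pcurl (u + v) = pcurl u + pcurl v := by
  funext c
  simp [pcurl]
  ring

lemma pcurl_sub (u v : VP3) : pcurl (u - v) = pcurl u - pcurl v := by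
  funext c
  simp [pcurl]
  ring

lemma pcurl_mul (f : P3) (v : VP3) (c : Fin 3) :
    pcurl (fun d => f * v d) c = f * pcurl v c + pcross (pgrad f) v c := by
  simp [pcurl, pcross, pgrad]
  ring

lemma degVle_pcurl {u : VP3} {m : ℕ} (h : degVle u m) : degVle (pcurl u) (m - 1) := fun _ =>
  (totalDegree_sub _ _).trans (max_le
    ((totalDegree_pderiv_le _ _).trans (Nat.sub_le_sub_right (h _) 1))
    ((totalDegree_pderiv_le _ _).trans (Nat.sub_le_sub_right (h _) 1)))

lemma pcurl_eq_zero_of_degVle_zero {u : VP3} (h : degVle u 0) : pcurl u = 0 := by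
  funext c
  have hc : ∀ d e, pderiv d (u e) = 0 := fun d e => by
    rw [totalDegree_eq_zero_iff_eq_C.1 (Nat.le_zero.1 (h e)), pderiv_C]
  simp [pcurl, hc]

/-- The normal component of the curl of a field vanishing on a plane vanishes there. -/
lemma affPoly_dvd_pcurl {a : V3} {c : ℝ} {u : VP3} (h : ∀ d, affPoly a c ∣ u d) :
    affPoly a c ∣ ∑ d, pcurl u d * C (a d) := by
  choose g hg using h
  obtain rfl : u = fun d => affPoly a c * g d := funext hg
  simp only [pcurl_mul, pcross, pgrad, pderiv_affPoly, Fin.sum_univ_three, Fin.isValue,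
    Fin.reduceAdd, zero_add]
  exact ⟨pcurl g 0 * C (a 0) + pcurl g 1 * C (a 1) + pcurl g 2 * C (a 2), by ring⟩

/-! ### Homogeneous representation in barycentric coordinates -/

/-- Total degree of a substitution of polynomials of degree at most one. -/
lemma totalDegree_aeval_le {σ τ : Type*} {u : σ → MvPolynomial τ ℝ}
    (hu : ∀ k, (u k).totalDegree ≤ 1) (F : MvPolynomial σ ℝ) :
    (aeval u F).totalDegree ≤ F.totalDegree := by
  rw [aeval_def, eval₂_eq]
  refine totalDegree_finsetSum_le fun α hα => (totalDegree_mul _ _).trans ?_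
  rw [algebraMap_eq, totalDegree_C, zero_add]
  refine (totalDegree_finsetProd _ _).trans (le_trans ?_ (le_totalDegree hα))
  exact Finset.sum_le_sum fun k _ => (totalDegree_pow _ _).trans
    ((Nat.mul_le_mul_left _ (hu k)).trans (mul_one _).le)

lemma exists_isHomogeneous_aeval_eq {L : Fin 4 → P3} {x : Fin 4 → V3} (hsum : ∑ k, L k = 1)
    (hX : ∀ d, X d = ∑ k, C (x k d) * L k) {f : P3} {m : ℕ} (hf : f.totalDegree ≤ m) :
    ∃ F : MvPolynomial (Fin 4) ℝ, F.IsHomogeneous m ∧ aeval L F = f := by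
  refine ⟨∑ α ∈ f.support, C (coeff α f) * ((∏ d, (∑ k, C (x k d) * X k) ^ α d) *
    (∑ k, X k) ^ (m - ∑ d, α d)), ?_, ?_⟩
  · refine IsHomogeneous.sum _ _ _ fun α hα => IsHomogeneous.C_mul ?_ _
    have hα' : ∑ d, α d ≤ m := by
      have := (le_totalDegree hα).trans hf
      rwa [Finsupp.sum_fintype _ _ (fun _ => rfl)] at this
    have h1 : (∏ d, (∑ k, C (x k d) * X k : MvPolynomial (Fin 4) ℝ) ^ α d).IsHomogeneous
        (∑ d, α d) := by
      refine IsHomogeneous.prod _ _ _ fun d _ => ?_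
      have := (IsHomogeneous.sum Finset.univ (fun k => C (x k d) * X k : Fin 4 → _) 1
        fun k _ => isHomogeneous_C_mul_X (x k d) k).pow (α d)
      rwa [one_mul] at this
    have h2 := (IsHomogeneous.sum Finset.univ (X : Fin 4 → MvPolynomial (Fin 4) ℝ) 1
        fun k _ => isHomogeneous_X ℝ k).pow (m - ∑ d, α d)
    have := h1.mul h2
    rwa [one_mul, Nat.add_sub_cancel' hα'] at this
  · simp only [map_sum, map_mul, map_prod, map_pow, aeval_X, algHom_C, algebraMap_eq, hsum, ← hX,
      one_pow, mul_one]
    conv_rhs => rw [f.as_sum]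
    refine Finset.sum_congr rfl fun α _ => ?_
    rw [monomial_eq, Finsupp.prod_fintype _ _ (fun _ => pow_zero _)]

lemma coeff_aeval_mask {σ : Type*} [Fintype σ] [DecidableEq σ] (S : Finset σ)
    (F : MvPolynomial σ ℝ) {α : σ →₀ ℕ} (hα : ∀ i ∈ S, α i = 0) :
    coeff α (aeval (fun k => if k ∈ S then 0 else X k : σ → MvPolynomial σ ℝ) F) = coeff α F := by
  induction F using MvPolynomial.induction_on' with
  | add p q hp hq => rw [map_add, coeff_add, coeff_add, hp, hq]
  | monomial β c =>
    rw [aeval_monomial, algebraMap_eq, coeff_C_mul, coeff_monomial,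
      Finsupp.prod_fintype _ _ (fun _ => pow_zero _)]
    by_cases hβ : ∀ i ∈ S, β i = 0
    · have : ∏ i, (if i ∈ S then 0 else X i : MvPolynomial σ ℝ) ^ β i = monomial β 1 := by
        rw [monomial_eq, C_1, one_mul, Finsupp.prod_fintype _ _ (fun _ => pow_zero _)]
        refine Finset.prod_congr rfl fun i _ => ?_
        by_cases hi : i ∈ S
        · simp [hβ i hi]
        · simp [hi]
      rw [this, coeff_monomial]
      simp
    · push Not at hβ
      obtain ⟨i, hi, hne⟩ := hβ
      rw [Finset.prod_eq_zero (Finset.mem_univ i) (by simp [hi, hne]), coeff_zero, mul_zero,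
        if_neg]
      rintro rfl
      exact hne (hα i hi)

lemma eval_smul_of_isHomogeneous {σ : Type*} [Fintype σ] {F : MvPolynomial σ ℝ} {m : ℕ}
    (hF : F.IsHomogeneous m) (s : ℝ) (y : σ → ℝ) : eval (s • y) F = s ^ m * eval y F := by
  simp only [eval_eq', Finset.mul_sum]
  refine Finset.sum_congr rfl fun α hα => ?_
  have := hF.degree_eq_sum_deg_support hα
  rw [Finset.sum_subset (Finset.subset_univ _)
    fun i _ hi => by simpa using hi] at this
  simp only [Pi.smul_apply, smul_eq_mul, mul_pow, Finset.prod_mul_distrib,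
    Finset.prod_pow_eq_pow_sum, ← this]
  ring

/-- A form vanishing on the part of the hyperplane `∑ y = 1` where the coordinates in `S` are zero
has no monomials supported off `S`. -/
lemma coeff_eq_zero_of_eval {σ : Type*} [Fintype σ] [DecidableEq σ] {S : Finset σ}
    (hS : ∃ k, k ∉ S) {F : MvPolynomial σ ℝ} {m : ℕ} (hF : F.IsHomogeneous m)
    (h : ∀ y : σ → ℝ, ∑ k, y k = 1 → (∀ i ∈ S, y i = 0) → eval y F = 0)
    {α : σ →₀ ℕ} (hα : ∀ i ∈ S, α i = 0) : coeff α F = 0 := by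
  rw [← coeff_aeval_mask S F hα]
  set M : σ → MvPolynomial σ ℝ := fun k => if k ∈ S then 0 else X k with hM
  suffices h0 : (∑ k, M k) * aeval M F = 0 by
    rcases mul_eq_zero.1 h0 with h1 | h1
    · obtain ⟨k, hk⟩ := hS
      have := congrArg (eval (Pi.single k 1)) h1
      simp [hM, Pi.single_apply, Finset.sum_ite, hk] at this
    · rw [h1, coeff_zero]
  refine MvPolynomial.funext fun y => ?_
  rw [map_zero, map_mul, map_sum]
  set y' : σ → ℝ := fun k => eval y (M k) with hy'
  rw [eval_aeval]
  change (∑ k, y' k) * _ = 0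
  by_cases hs : ∑ k, y' k = 0
  · rw [hs, zero_mul]
  have h1 : eval ((∑ k, y' k)⁻¹ • y') F = 0 := by
    apply h
    · simp only [Pi.smul_apply, smul_eq_mul, ← Finset.mul_sum]
      exact inv_mul_cancel₀ hs
    · intro i hi
      simp [hy', hM, hi]
  rw [eval_smul_of_isHomogeneous hF] at h1
  rw [(mul_eq_zero.1 h1).resolve_left (pow_ne_zero _ (inv_ne_zero hs)), mul_zero]

/-! ### Barycentric coordinates -/

/-- The affine polynomials `affPoly (a i) (c i)` are the barycentric coordinates of the tetrahedron
with vertices `x`. -/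
structure IsBaryCoords (x a : Fin 4 → V3) (c : Fin 4 → ℝ) : Prop where
  vertex : ∀ i k, eval (x k) (affPoly (a i) (c i)) = if i = k then 1 else 0
  sum_eq_one : ∑ k, affPoly (a k) (c k) = 1
  X_eq : ∀ d, X d = ∑ k, C (x k d) * affPoly (a k) (c k)

lemma exists_isBaryCoords {x : Fin 4 → V3} (hx : AffineIndependent ℝ x) :
    ∃ a c, IsBaryCoords x a c := by
  have htop : affineSpan ℝ (Set.range x) = ⊤ :=
    hx.affineSpan_eq_top_iff_card_eq_finrank_add_one.2 (by simp)
  let b : AffineBasis (Fin 4) ℝ V3 := ⟨x, hx, htop⟩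
  have key : ∀ i y, eval y (affPoly (fun d => (b.coord i).linear (Pi.single d 1)) (b.coord i 0)) =
      b.coord i y := by
    intro i y
    have h : (b.coord i).linear y = ∑ d, (b.coord i).linear (Pi.single d 1) * y d := by
      conv_lhs => rw [pi_eq_sum_univ' y, map_sum]
      refine Finset.sum_congr rfl fun d _ => ?_
      rw [map_smul, smul_eq_mul, mul_comm]
    rw [eval_affPoly, ← h, congrFun (AffineMap.decomp (b.coord i)) y, Pi.add_apply, add_comm]
  refine ⟨fun i d => (b.coord i).linear (Pi.single d 1), fun i => b.coord i 0, ?_, ?_, ?_⟩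
  · intro i k
    rw [key]
    exact b.coord_apply i k
  · refine MvPolynomial.funext fun y => ?_
    rw [map_sum, map_one]
    simp only [key]
    exact b.sum_coord_apply_eq_one y
  · intro d
    refine MvPolynomial.funext fun y => ?_
    rw [map_sum, eval_X]
    simp only [key, map_mul, eval_C]
    have := congrFun (b.linear_combination_coord_eq_self y) d
    rw [← this, Finset.sum_apply]
    exact Finset.sum_congr rfl fun k _ => mul_comm _ _

namespace IsBaryCoords

variable {x a : Fin 4 → V3} {c : Fin 4 → ℝ}

lemma sum_grad (H : IsBaryCoords x a c) : ∑ k, a k = 0 := by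
  funext d
  have h := congrArg (pderiv d) H.sum_eq_one
  simp only [map_sum, pderiv_affPoly, pderiv_one] at h
  rw [← map_sum] at h
  simpa using C_eq_zero.1 h

lemma eq_zero_of_dotProduct (H : IsBaryCoords x a c) {u : V3} (hu : ∀ k, u ⬝ᵥ a k = 0) :
    u = 0 := by
  funext d
  have h : ∀ e, (if d = e then 1 else 0 : ℝ) = ∑ k, x k d * a k e := by
    intro e
    have h := congrArg (pderiv e) (H.X_eq d)
    simp only [map_sum, pderiv_C_mul, pderiv_affPoly, pderiv_X, Pi.single_apply, ← C_mul] at h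
    rw [← map_sum] at h
    apply C_injective (Fin 3) ℝ
    rw [← h]
    split_ifs <;> simp_all
  calc u d = ∑ e, (if d = e then 1 else 0) * u e := by simp
    _ = ∑ e, ∑ k, x k d * (u e * a k e) := by
      refine Finset.sum_congr rfl fun e _ => ?_
      rw [h, Finset.sum_mul]
      exact Finset.sum_congr rfl fun k _ => by ring
    _ = ∑ k, x k d * (u ⬝ᵥ a k) := by
      rw [Finset.sum_comm]
      simp [dotProduct, Finset.mul_sum]
    _ = 0 := by simp [hu]

lemma grad_ne_zero (H : IsBaryCoords x a c) (i : Fin 4) : a i ≠ 0 := by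
  intro h
  obtain ⟨j, hj⟩ := exists_ne i
  have h1 := H.vertex i i
  have h2 := H.vertex i j
  simp only [eval_affPoly, h, hj.symm, if_true, if_false, Pi.zero_apply, zero_mul,
    Finset.sum_const_zero] at h1 h2
  linarith

lemma grad_sub_ne_zero (H : IsBaryCoords x a c) {i j : Fin 4} (hij : i ≠ j) : a i - a j ≠ 0 := by
  intro h
  rw [sub_eq_zero] at h
  have h1 := H.vertex i i
  have h2 := H.vertex i j
  have h3 := H.vertex j j
  have h4 := H.vertex j i
  simp only [eval_affPoly, h, hij, hij.symm, if_true, if_false] at h1 h2 h3 h4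
  linarith

lemma eval_combination (H : IsBaryCoords x a c) {y : Fin 4 → ℝ} (hy : ∑ k, y k = 1) (i : Fin 4) :
    eval (∑ k, y k • x k) (affPoly (a i) (c i)) = y i := by
  have h1 : ∀ k, c i + ∑ d, a i d * x k d = if i = k then 1 else 0 := fun k => by
    rw [← eval_affPoly, H.vertex]
  calc eval (∑ k, y k • x k) (affPoly (a i) (c i))
      = (∑ k, y k) * c i + ∑ d, a i d * ∑ k, y k * x k d := by
        rw [hy, one_mul, eval_affPoly]
        simp
    _ = ∑ k, y k * (c i + ∑ d, a i d * x k d) := by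
        simp only [Finset.mul_sum, mul_add, Finset.sum_add_distrib, Finset.sum_mul]
        rw [Finset.sum_comm]
        congr 1
        exact Finset.sum_congr rfl fun k _ => Finset.sum_congr rfl fun d _ => by ring
    _ = y i := by simp [h1]

lemma combination_eval (H : IsBaryCoords x a c) (y : V3) :
    ∑ k, eval y (affPoly (a k) (c k)) • x k = y := by
  funext d
  have := congrArg (eval y) (H.X_eq d)
  simp only [eval_X, map_sum, map_mul, eval_C] at this
  rw [this, Finset.sum_apply]
  exact Finset.sum_congr rfl fun k _ => by simp [mul_comm]

lemma sum_eval (H : IsBaryCoords x a c) (y : V3) : ∑ k, eval y (affPoly (a k) (c k)) = 1 := by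
  rw [← map_sum, H.sum_eq_one, map_one]

end IsBaryCoords

/-! ### Recovering a vector from its cross products -/

lemma cross3_dotProduct_self (u w : V3) : cross3 u w ⬝ᵥ u = 0 := by
  simp only [cross3, dotProduct, Fin.sum_univ_three, Fin.isValue, Fin.reduceAdd, zero_add]
  ring

lemma cross3_dotProduct_comm (u v w : V3) : cross3 u w ⬝ᵥ v = -(cross3 v w ⬝ᵥ u) := by
  simp only [cross3, dotProduct, Fin.sum_univ_three, Fin.isValue, Fin.reduceAdd, zero_add]
  ring

lemma cross3_sum_left {ι : Type*} (s : Finset ι) (u : ι → V3) (w : V3) :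
    cross3 (∑ i ∈ s, u i) w = ∑ i ∈ s, cross3 (u i) w := by
  funext d
  simp [cross3, Finset.sum_mul]

/-- Any skew-symmetric form on a basis of `ℝ³` is a triple product with a fixed vector. -/
lemma exists_cross3_dotProduct_eq {b : Fin 3 → V3} (hb : (Matrix.of b).det ≠ 0)
    {M : Fin 3 → Fin 3 → ℝ} (hM : ∀ i j, M i j = -M j i) :
    ∃ w, ∀ i j, cross3 (b i) w ⬝ᵥ b j = M i j := by
  have hd : ∀ i, M i i = 0 := fun i => by linarith [hM i i]
  have h1 : ∀ w, (∀ i j, i < j → cross3 (b i) w ⬝ᵥ b j = M i j) →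
      ∀ i j, cross3 (b i) w ⬝ᵥ b j = M i j := by
    intro w h i j
    rcases lt_trichotomy i j with hij | rfl | hij
    · exact h i j hij
    · rw [cross3_dotProduct_self, hd]
    · rw [cross3_dotProduct_comm, h j i hij, hM i j]
  refine ⟨-(Matrix.of b).det⁻¹ • (M 1 2 • b 0 + M 2 0 • b 1 + M 0 1 • b 2), h1 _ ?_⟩
  intro i j hij
  have he := mul_inv_cancel₀ hb
  generalize (Matrix.of b).det⁻¹ = e at he ⊢
  rw [Matrix.det_fin_three] at he
  rw [hM 2 0]
  simp only [cross3, dotProduct, Fin.sum_univ_three, Fin.isValue, Fin.reduceAdd, zero_add,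
    Pi.smul_apply, Pi.add_apply, smul_eq_mul, Matrix.of_apply] at *
  obtain ⟨rfl, rfl⟩ | ⟨rfl, rfl⟩ | ⟨rfl, rfl⟩ : i = 0 ∧ j = 1 ∨ i = 0 ∧ j = 2 ∨ i = 1 ∧ j = 2 := by
    revert hij
    revert i j
    decide
  · linear_combination M 0 1 * he
  · linear_combination M 0 2 * he
  · linear_combination M 1 2 * he

lemma IsBaryCoords.exists_cross3_eq {x a : Fin 4 → V3} {c : Fin 4 → ℝ} (H : IsBaryCoords x a c)
    (S : Finset (Fin 4)) {V : Fin 4 → V3}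
    (hV : ∀ i ∈ S, ∀ j ∈ S, V i ⬝ᵥ a j = -(V j ⬝ᵥ a i)) :
    ∃ w, ∀ i ∈ S, cross3 (a i) w = V i := by
  obtain ⟨k, hk⟩ : ∃ k, S = Finset.univ ∨ k ∉ S := by
    by_cases h : S = Finset.univ
    · exact ⟨0, Or.inl h⟩
    · rw [Finset.eq_univ_iff_forall] at h
      push Not at h
      exact h.imp fun k => Or.inr
  have hsum : a k = -∑ i, a (k.succAbove i) := by
    rw [eq_neg_iff_add_eq_zero, ← Fin.sum_univ_succAbove a k, H.sum_grad]
  have hspan : ∀ u : V3, (∀ i, u ⬝ᵥ a (k.succAbove i) = 0) → u = 0 := by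
    intro u hu
    refine H.eq_zero_of_dotProduct fun j => ?_
    rcases Fin.eq_self_or_eq_succAbove k j with rfl | ⟨i, rfl⟩
    · rw [hsum, dotProduct_neg, dotProduct_sum]
      simp [hu]
    · exact hu i
  have hdet : (Matrix.of fun i => a (k.succAbove i)).det ≠ 0 := by
    intro h
    obtain ⟨u, hu0, hu⟩ := Matrix.exists_mulVec_eq_zero_iff.2 h
    refine hu0 (hspan u fun i => ?_)
    rw [dotProduct_comm]
    exact congrFun hu i
  obtain ⟨w, hw⟩ := exists_cross3_dotProduct_eq hdet
    (M := fun i j => if k.succAbove i ∈ S then V (k.succAbove i) ⬝ᵥ a (k.succAbove j) else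
      if k.succAbove j ∈ S then -(V (k.succAbove j) ⬝ᵥ a (k.succAbove i)) else 0) (by
      intro i j
      by_cases hi : k.succAbove i ∈ S <;> by_cases hj : k.succAbove j ∈ S <;> simp [hi, hj]
      exact hV _ hi _ hj)
  have hw' : ∀ i, k.succAbove i ∈ S → cross3 (a (k.succAbove i)) w = V (k.succAbove i) := by
    intro i hi
    rw [← sub_eq_zero]
    refine hspan _ fun j => ?_
    rw [sub_dotProduct, hw i j, if_pos hi, sub_self]
  refine ⟨w, fun i hi => ?_⟩
  rcases Fin.eq_self_or_eq_succAbove k i with rfl | ⟨i, rfl⟩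
  · obtain rfl := hk.resolve_right (not_not.2 hi)
    have hVsum : ∑ j, V j = 0 := by
      refine H.eq_zero_of_dotProduct fun j => ?_
      rw [sum_dotProduct, Finset.sum_congr rfl fun l _ =>
        hV l (Finset.mem_univ l) j (Finset.mem_univ j), Finset.sum_neg_distrib, ← dotProduct_sum,
        H.sum_grad, dotProduct_zero, neg_zero]
    have ha : ∑ j, cross3 (a j) w = 0 := by
      rw [← cross3_sum_left, H.sum_grad]
      funext d
      simp [cross3]
    rw [Fin.sum_univ_succAbove _ i] at hVsum ha
    rw [Finset.sum_congr rfl fun j _ => hw' j (Finset.mem_univ _)] at ha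
    exact add_right_cancel (ha.trans hVsum.symm)
  · exact hw' i hi

/-! ### The correction field -/

lemma coeff_pcross {σ : Type*} (u : V3) (W : Fin 3 → MvPolynomial σ ℝ) (d : Fin 3) (α : σ →₀ ℕ) :
    coeff α (C (u (d + 1)) * W (d + 2) - C (u (d + 2)) * W (d + 1)) =
      cross3 u (fun e => coeff α (W e)) d := by
  simp [cross3, coeff_C_mul]

lemma IsBaryCoords.exists_continuous_tangential_lift {x a : Fin 4 → V3} {c : Fin 4 → ℝ}
    (H : IsBaryCoords x a c) {m : ℕ} {v : Fin 4 → VP3} (hdeg : ∀ i, degVle (v i) m)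
    (hA : ∀ i, affPoly (a i) (c i) ∣ ∑ d, v i d * C (a i d))
    (hB : ∀ i j, i ≠ j → affPoly (a i) (c i) - affPoly (a j) (c j) ∣
      ∑ d, (v i d - v j d) * C (a i d - a j d)) :
    ∃ w : Fin 4 → VP3, (∀ i, degVle (w i) m) ∧
      (∀ i j d, affPoly (a i) (c i) - affPoly (a j) (c j) ∣ w i d - w j d) ∧
      ∀ i d, affPoly (a i) (c i) ∣
        v i d - pcross (pgrad (affPoly (a i) (c i))) (w i) d := by
  set L : Fin 4 → P3 := fun i => affPoly (a i) (c i) with hL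
  choose V hVhom hV using fun i d =>
    exists_isHomogeneous_aeval_eq (L := L) H.sum_eq_one H.X_eq (hdeg i d)
  have heval : ∀ y : Fin 4 → ℝ, ∑ k, y k = 1 → ∀ F,
      eval y F = eval (∑ k, y k • x k) (aeval L F) := by
    intro y hy F
    rw [eval_aeval]
    congr 2
    funext i
    exact (H.eval_combination hy i).symm
  have hdiag : ∀ α : Fin 4 →₀ ℕ, ∀ i, α i = 0 → ∑ d, coeff α (V i d) * a i d = 0 := by
    intro α i hi
    have hF : (∑ d, V i d * C (a i d)).IsHomogeneous m :=
      IsHomogeneous.sum _ _ _ fun d _ => (hVhom i d).mul (isHomogeneous_C _ _)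
    have h : ∀ y : Fin 4 → ℝ, ∑ k, y k = 1 → (∀ k ∈ ({i} : Finset (Fin 4)), y k = 0) →
        eval y (∑ d, V i d * C (a i d)) = 0 := by
      intro y hy hyi
      rw [heval y hy]
      refine eval_eq_zero_of_dvd (l := L i) ?_ ?_
      · simp only [map_sum, map_mul, algHom_C, algebraMap_eq, hV]
        exact hA i
      · rw [H.eval_combination hy, hyi i (by simp)]
    have hS : ∀ i : Fin 4, ∃ k, k ∉ ({i} : Finset (Fin 4)) := by decide
    have := coeff_eq_zero_of_eval (hS i) hF h (α := α) (by simpa using hi)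
    simp only [coeff_sum, mul_comm _ (C _), coeff_C_mul] at this
    simpa only [mul_comm] using this
  have hskew : ∀ α : Fin 4 →₀ ℕ, ∀ i j, α i = 0 → α j = 0 →
      ∑ d, coeff α (V i d) * a j d = -∑ d, coeff α (V j d) * a i d := by
    intro α i j hi hj
    rcases eq_or_ne i j with rfl | hij
    · rw [hdiag α i hi, neg_zero]
    have hF : (∑ d, (V i d - V j d) * C (a i d - a j d)).IsHomogeneous m :=
      IsHomogeneous.sum _ _ _ fun d _ =>
        ((hVhom i d).sub (hVhom j d)).mul (isHomogeneous_C _ _)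
    have h : ∀ y : Fin 4 → ℝ, ∑ k, y k = 1 → (∀ k ∈ ({i, j} : Finset (Fin 4)), y k = 0) →
        eval y (∑ d, (V i d - V j d) * C (a i d - a j d)) = 0 := by
      intro y hy hyi
      rw [heval y hy]
      refine eval_eq_zero_of_dvd (l := L i - L j) ?_ ?_
      · simp only [map_sum, map_mul, algHom_C, algebraMap_eq, map_sub, hV]
        simpa only [map_sub] using hB i j hij
      · rw [map_sub, H.eval_combination hy, H.eval_combination hy, hyi i (by simp),
          hyi j (by simp), sub_zero]
    have hS : ∀ i j : Fin 4, ∃ k, k ∉ ({i, j} : Finset (Fin 4)) := by decide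
    have := coeff_eq_zero_of_eval (hS i j) hF h (α := α) (by simp [hi, hj])
    have h1 := hdiag α i hi
    have h2 := hdiag α j hj
    simp only [coeff_add, mul_comm _ (C _), coeff_C_mul, coeff_sub, Fin.sum_univ_three]
      at this h1 h2 ⊢
    linear_combination h1 + h2 - this
  have hW : ∀ α : Fin 4 →₀ ℕ, ∃ W : V3, ∀ i, α i = 0 →
      cross3 (a i) W = fun d => coeff α (V i d) := by
    intro α
    obtain ⟨W, hW⟩ := H.exists_cross3_eq (Finset.univ.filter fun i => α i = 0)
      (V := fun i d => coeff α (V i d)) (fun i hi j hj => hskew α i j (by simpa using hi)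
        (by simpa using hj))
    exact ⟨W, fun i hi => hW i (by simpa using hi)⟩
  choose W hW using hW
  let A : Finset (Fin 4 →₀ ℕ) := Finset.univ.biUnion fun i => Finset.univ.biUnion fun d =>
    (V i d).support
  let P : Fin 3 → MvPolynomial (Fin 4) ℝ := fun d => ∑ α ∈ A, monomial α (W α d)
  have hA_deg : ∀ α ∈ A, α.degree = m := by
    intro α hα
    obtain ⟨i, -, hα⟩ := Finset.mem_biUnion.1 hα
    obtain ⟨d, -, hα⟩ := Finset.mem_biUnion.1 hα
    by_contra hne
    exact mem_support_iff.1 hα ((hVhom i d).coeff_eq_zero hne)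
  have hP_hom : ∀ d, (P d).IsHomogeneous m := fun d =>
    IsHomogeneous.sum _ _ _ fun α hα => isHomogeneous_monomial _ (hA_deg α hα)
  have hP_coeff : ∀ α d, coeff α (P d) = if α ∈ A then W α d else 0 := by
    intro α d
    simp [P, coeff_sum, coeff_monomial]
  have hPV : ∀ α i d, α i = 0 →
      coeff α (V i d - (C (a i (d + 1)) * P (d + 2) - C (a i (d + 2)) * P (d + 1))) = 0 := by
    intro α i d hi
    rw [coeff_sub, coeff_pcross, sub_eq_zero]
    by_cases hα : α ∈ A
    · simp only [hP_coeff, hα, if_true]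
      exact (congrFun (hW α i hi) d).symm
    · have : coeff α (V i d) = 0 := by
        by_contra h
        exact hα (Finset.mem_biUnion.2 ⟨i, Finset.mem_univ _, Finset.mem_biUnion.2
          ⟨d, Finset.mem_univ _, mem_support_iff.2 h⟩⟩)
      simp [this, hP_coeff, hα, cross3]
  refine ⟨fun i d => aeval (fun k => L k - L i) (P d), fun i d => ?_, fun i j d => ?_,
    fun i d => ?_⟩
  · refine (totalDegree_aeval_le (fun k => ?_) _).trans (hP_hom d).totalDegree_le
    simp only [hL, affPoly_sub]
    exact totalDegree_affPoly_le _ _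
  · exact dvd_aeval_sub_aeval (fun k => ⟨-1, by ring⟩) _
  · refine affPoly_dvd_of_eval (H.grad_ne_zero i) fun y hy => ?_
    have h0 : eval (fun k => eval y (L k))
        (V i d - (C (a i (d + 1)) * P (d + 2) - C (a i (d + 2)) * P (d + 1))) = 0 := by
      rw [eval_eq']
      refine Finset.sum_eq_zero fun α hα => mul_eq_zero_of_right _ ?_
      refine Finset.prod_eq_zero (Finset.mem_univ i) ?_
      have hαi : α i ≠ 0 := fun h => mem_support_iff.1 hα (hPV α i d h)
      simp [hL, hy, hαi]
    rw [← h0, ← hV i d]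
    simp only [pcross, pgrad, pderiv_affPoly, map_sub, map_mul, eval_C, eval_aeval]
    simp [hL, hy]

/-! ### The potential -/

lemma pcurl_affPoly_pow_mul (a : V3) (c : ℝ) (s : ℕ) (u : VP3) (d : Fin 3) :
    pcurl (fun e => affPoly a c ^ (s + 1) * u e) d = affPoly a c ^ s *
      ((s + 1) * pcross (fun e => C (a e)) u d + affPoly a c * pcurl u d) := by
  simp only [pcurl_mul, pcross, pgrad, pderiv_pow, pderiv_affPoly]
  push_cast [Nat.add_sub_cancel]
  ring

lemma pdiv_affPoly_pow_mul (a : V3) (c : ℝ) (s : ℕ) (v : VP3) :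
    pdiv (fun e => affPoly a c ^ (s + 1) * v e) = affPoly a c ^ s *
      ((s + 1) * ∑ d, v d * C (a d) + affPoly a c * pdiv v) := by
  simp only [pdiv_mul, pderiv_pow, pderiv_affPoly, Fin.sum_univ_three]
  push_cast [Nat.add_sub_cancel]
  ring

namespace IsBaryCoords

variable {x a : Fin 4 → V3} {c : Fin 4 → ℝ}

lemma eval_bary (H : IsBaryCoords x a c) (i : Fin 4) :
    eval (bary x) (affPoly (a i) (c i)) = 4⁻¹ := by
  have h : bary x = ∑ k, (4⁻¹ : ℝ) • x k := by
    simp [bary, Fin.sum_univ_four]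
  rw [h, H.eval_combination (y := fun _ => 4⁻¹) (by norm_num)]

lemma not_dvd (H : IsBaryCoords x a c) (i j k : Fin 4) :
    ¬affPoly (a i) (c i) - affPoly (a j) (c j) ∣ affPoly (a k) (c k) := fun h => by
  have := eval_eq_zero_of_dvd h (y := bary x) (by simp [H.eval_bary])
  rw [H.eval_bary] at this
  norm_num at this

lemma dvd_of_dvd_mul (H : IsBaryCoords x a c) {i j : Fin 4} (hij : i ≠ j) {k : Fin 4} {f : P3}
    (h : affPoly (a i) (c i) - affPoly (a j) (c j) ∣ affPoly (a k) (c k) * f) :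
    affPoly (a i) (c i) - affPoly (a j) (c j) ∣ f := by
  have h' := H.not_dvd i j k
  rw [affPoly_sub] at *
  exact (affPoly_dvd_mul (H.grad_sub_ne_zero hij) h).resolve_left h'

/-- One step of the construction of the potential: up to the curl of a continuous field vanishing
to order `s + 1` on the boundary, the field `L ^ s * v` vanishes to order `s + 1`. -/
lemma exists_potential_step (H : IsBaryCoords x a c) {m s : ℕ} {v : Fin 4 → VP3}
    (hdeg : ∀ i, degVle (v i) m)
    (hA : ∀ i, affPoly (a i) (c i) ∣ ∑ d, v i d * C (a i d))
    (hB : ∀ i j, i ≠ j → affPoly (a i) (c i) - affPoly (a j) (c j) ∣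
      ∑ d, (v i d - v j d) * C (a i d - a j d))
    (hdiv : ∀ i, pdiv (fun d => affPoly (a i) (c i) ^ s * v i d) = 0) :
    ∃ u v' : Fin 4 → VP3, (∀ i, degVle (u i) m) ∧
      (∀ i j d, affPoly (a i) (c i) - affPoly (a j) (c j) ∣ u i d - u j d) ∧
      (∀ i d, affPoly (a i) (c i) ^ s * v i d =
        pcurl (fun e => affPoly (a i) (c i) ^ (s + 1) * u i e) d +
          affPoly (a i) (c i) ^ (s + 1) * v' i d) ∧
      (∀ i, degVle (v' i) (m - 1)) ∧ (m = 0 → v' = 0) ∧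
      (∀ i, affPoly (a i) (c i) ∣ ∑ d, v' i d * C (a i d)) ∧
      (∀ i j, i ≠ j → affPoly (a i) (c i) - affPoly (a j) (c j) ∣
        ∑ d, (v' i d - v' j d) * C (a i d - a j d)) ∧
      (∀ i, pdiv (fun d => affPoly (a i) (c i) ^ (s + 1) * v' i d) = 0) := by
  obtain ⟨w, hwdeg, hwcont, hw⟩ := H.exists_continuous_tangential_lift hdeg hA hB
  choose g hg using hw
  have hs : C ((s + 1 : ℝ)⁻¹) * ((s : P3) + 1) = 1 := by
    have : (s : P3) + 1 = C (s + 1 : ℝ) := by simp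
    rw [this, ← C_mul, inv_mul_cancel₀ (by positivity), C_1]
  obtain ⟨u, hu⟩ : ∃ u : Fin 4 → VP3, ∀ i d, u i d = C ((s + 1 : ℝ)⁻¹) * w i d :=
    ⟨_, fun _ _ => rfl⟩
  have hudeg : ∀ i, degVle (u i) m := fun i d => by
    rw [hu]
    refine (totalDegree_mul _ _).trans ?_
    rw [totalDegree_C, zero_add]
    exact hwdeg i d
  have hucont : ∀ i j d, affPoly (a i) (c i) - affPoly (a j) (c j) ∣ u i d - u j d :=
    fun i j d => by
      rw [hu, hu, ← mul_sub]
      exact (hwcont i j d).mul_left _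
  have hv : ∀ i d, v i d = (s + 1) * pcross (fun e => C (a i e)) (u i) d +
      affPoly (a i) (c i) * g i d := by
    intro i d
    have h := hg i d
    simp only [pcross, pgrad, pderiv_affPoly, hu] at h ⊢
    linear_combination h - (C (a i (d + 1)) * w i (d + 2) - C (a i (d + 2)) * w i (d + 1)) * hs
  have hgdeg : ∀ i d, g i d ≠ 0 → (g i d).totalDegree + 1 ≤ m := by
    intro i d h0
    rw [add_comm, ← totalDegree_affPoly (H.grad_ne_zero i) (c i),
      ← totalDegree_mul_of_isDomain (affPoly_ne_zero (H.grad_ne_zero i) _) h0, ← hg]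
    refine (totalDegree_sub _ _).trans (max_le (hdeg i d) ?_)
    simp only [pcross, pgrad, pderiv_affPoly]
    refine (totalDegree_sub _ _).trans (max_le ?_ ?_) <;>
    · refine (totalDegree_mul _ _).trans ?_
      rw [totalDegree_C, zero_add]
      exact hwdeg i _
  obtain ⟨v', hv'⟩ : ∃ v' : Fin 4 → VP3, ∀ i d, v' i d = g i d - pcurl (u i) d :=
    ⟨_, fun _ _ => rfl⟩
  have hstep : ∀ i d, affPoly (a i) (c i) ^ s * v i d =
      pcurl (fun e => affPoly (a i) (c i) ^ (s + 1) * u i e) d +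
        affPoly (a i) (c i) ^ (s + 1) * v' i d := by
    intro i d
    rw [pcurl_affPoly_pow_mul, hv' i d, hv i d]
    ring
  have hdiv' : ∀ i, pdiv (fun d => affPoly (a i) (c i) ^ (s + 1) * v' i d) = 0 := by
    intro i
    have h : (fun d => affPoly (a i) (c i) ^ (s + 1) * v' i d) =
        (fun d => affPoly (a i) (c i) ^ s * v i d) -
          pcurl (fun e => affPoly (a i) (c i) ^ (s + 1) * u i e) := by
      funext d
      rw [Pi.sub_apply, hstep, add_sub_cancel_left]
    rw [h, pdiv_sub, hdiv, pdiv_pcurl, sub_zero]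
  refine ⟨u, v', hudeg, hucont, hstep, fun i d => ?_, ?_, fun i => ?_, fun i j hij => ?_, hdiv'⟩
  · rw [hv']
    refine (totalDegree_sub _ _).trans (max_le ?_ (degVle_pcurl (hudeg i) d))
    by_cases h0 : g i d = 0
    · simp [h0]
    · have := hgdeg i d h0
      omega
  · rintro rfl
    funext i d
    rw [hv', pcurl_eq_zero_of_degVle_zero (hudeg i)]
    by_contra h0
    have := hgdeg i d (by simpa using h0)
    omega
  · have h := hdiv' i
    rw [pdiv_affPoly_pow_mul] at h
    have h := (mul_eq_zero.1 h).resolve_left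
      (pow_ne_zero _ (affPoly_ne_zero (H.grad_ne_zero i) _))
    refine ⟨-C ((s + 1 : ℝ)⁻¹) * pdiv (v' i), ?_⟩
    linear_combination C ((s + 1 : ℝ)⁻¹) * h - (∑ d, v' i d * C (a i d)) * hs
  · refine H.dvd_of_dvd_mul hij (k := i) ?_
    obtain ⟨b, hb⟩ := hB i j hij
    choose e he using hucont i j
    have hcurl := affPoly_dvd_pcurl (a := a i - a j) (c := c i - c j) (u := u i - u j)
      (fun d => by rw [← affPoly_sub]; exact hucont i j d)
    rw [← affPoly_sub, pcurl_sub] at hcurl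
    obtain ⟨k, hk⟩ := hcurl
    simp only [Fin.sum_univ_three, hv, hv', pcross, Pi.sub_apply, C_sub, Fin.isValue, Fin.reduceAdd,
      zero_add] at hb hk ⊢
    have h0 := he 0
    have h1 := he 1
    have h2 := he 2
    generalize affPoly (a i) (c i) = Li at *
    generalize affPoly (a j) (c j) = Lj at *
    generalize (C (a i 0) : P3) = α0 at *
    generalize (C (a i 1) : P3) = α1 at *
    generalize (C (a i 2) : P3) = α2 at *
    generalize (C (a j 0) : P3) = β0 at *
    generalize (C (a j 1) : P3) = β1 at *
    generalize (C (a j 2) : P3) = β2 at *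
    refine ⟨b - (g j 0 * (α0 - β0) + g j 1 * (α1 - β1) + g j 2 * (α2 - β2)) - Li * k +
      (s + 1) * ((α1 * e 2 - α2 * e 1) * β0 + (α2 * e 0 - α0 * e 2) * β1 +
        (α0 * e 1 - α1 * e 0) * β2), ?_⟩
    linear_combination hb - Li * hk + (s + 1) * ((α1 * h2 - α2 * h1) * β0 +
      (α2 * h0 - α0 * h2) * β1 + (α0 * h1 - α1 * h0) * β2)

lemma exists_potential (H : IsBaryCoords x a c) (m : ℕ) : ∀ (s : ℕ) (v : Fin 4 → VP3),
    (∀ i, degVle (v i) m) →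
    (∀ i, affPoly (a i) (c i) ∣ ∑ d, v i d * C (a i d)) →
    (∀ i j, i ≠ j → affPoly (a i) (c i) - affPoly (a j) (c j) ∣
      ∑ d, (v i d - v j d) * C (a i d - a j d)) →
    (∀ i, pdiv (fun d => affPoly (a i) (c i) ^ s * v i d) = 0) →
    ∃ Q : Fin 4 → VP3, (∀ i, degVle (Q i) m) ∧
      (∀ i j d, affPoly (a i) (c i) - affPoly (a j) (c j) ∣ Q i d - Q j d) ∧
      ∀ i, pcurl (fun d => affPoly (a i) (c i) ^ (s + 1) * Q i d) =
        fun d => affPoly (a i) (c i) ^ s * v i d := by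
  induction m with
  | zero =>
    intro s v hdeg hA hB hdiv
    obtain ⟨u, v', hudeg, hucont, hstep, -, hv', -⟩ := H.exists_potential_step hdeg hA hB hdiv
    refine ⟨u, hudeg, hucont, fun i => funext fun d => ?_⟩
    simp [hstep, hv' rfl]
  | succ m ih =>
    intro s v hdeg hA hB hdiv
    obtain ⟨u, v', hudeg, hucont, hstep, hdeg', -, hA', hB', hdiv'⟩ :=
      H.exists_potential_step hdeg hA hB hdiv
    obtain ⟨Q, hQdeg, hQcont, hQ⟩ := ih (s + 1) v' hdeg' hA' hB' hdiv'
    refine ⟨fun i d => u i d + affPoly (a i) (c i) * Q i d, fun i d => ?_, fun i j d => ?_,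
      fun i => funext fun d => ?_⟩
    · refine (totalDegree_add _ _).trans (max_le (hudeg i d) ((totalDegree_mul _ _).trans ?_))
      rw [add_comm]
      exact add_le_add (hQdeg i d) (totalDegree_affPoly_le _ _)
    · have h : u i d + affPoly (a i) (c i) * Q i d - (u j d + affPoly (a j) (c j) * Q j d) =
          (u i d - u j d) + (affPoly (a i) (c i) * (Q i d - Q j d) +
            (affPoly (a i) (c i) - affPoly (a j) (c j)) * Q j d) := by ring
      rw [h]
      exact dvd_add (hucont i j d) (dvd_add ((hQcont i j d).mul_left _) (dvd_mul_right _ _))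
    · have h : (fun d => affPoly (a i) (c i) ^ (s + 1) * (u i d + affPoly (a i) (c i) * Q i d)) =
          (fun d => affPoly (a i) (c i) ^ (s + 1) * u i d) +
            fun d => affPoly (a i) (c i) ^ (s + 1 + 1) * Q i d := by
        funext d
        simp only [Pi.add_apply]
        ring
      rw [h, pcurl_add, Pi.add_apply, hQ, hstep]

end IsBaryCoords

/-! ### From faces to divisibility -/

/-- A polynomial vanishing on the convex hull of finitely many points vanishes on their affine
span. -/
lemma eval_eq_zero_of_convexHull {ι : Type*} [Fintype ι] [Nonempty ι] {P : ι → V3} {f : P3}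
    (h : ∀ y ∈ convexHull ℝ (Set.range P), eval y f = 0) {w : ι → ℝ} (hw : ∑ k, w k = 1) :
    eval (∑ k, w k • P k) f = 0 := by
  set n : ℝ := (Fintype.card ι : ℝ) with hn
  have hn0 : 0 < n := by
    rw [hn]
    exact_mod_cast Fintype.card_pos
  let W : ι → Polynomial ℝ := fun k =>
    Polynomial.C n⁻¹ + Polynomial.X * Polynomial.C (w k - n⁻¹)
  let F : Polynomial ℝ := aeval (fun d => ∑ k, W k * Polynomial.C (P k d)) f
  have hF : ∀ t, F.eval t = eval (∑ k, (W k).eval t • P k) f := by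
    intro t
    have h1 := comp_aeval_apply (fun d => ∑ k, W k * Polynomial.C (P k d))
      (Polynomial.aeval t : Polynomial ℝ →ₐ[ℝ] ℝ) f
    rw [Polynomial.coe_aeval_eq_eval] at h1
    rw [h1]
    change eval _ f = _
    congr 2
    funext d
    simp [Polynomial.eval_finsetSum]
  have hsum : ∀ t, ∑ k, (W k).eval t = 1 := by
    intro t
    simp [W, Finset.sum_add_distrib, ← Finset.mul_sum, hw, ← hn, hn0.ne']
  have hroot : ∀ᶠ t in nhds (0 : ℝ), F.IsRoot t := by
    have hpos : ∀ k, ∀ᶠ t in nhds (0 : ℝ), 0 < (W k).eval t := by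
      intro k
      refine (W k).continuous.continuousAt.eventually_const_lt ?_
      simpa [W] using hn0
    filter_upwards [Filter.eventually_all.2 hpos] with t ht
    rw [Polynomial.IsRoot, hF]
    exact h _ ((convex_convexHull ℝ _).sum_mem (fun k _ => (ht k).le) (hsum t)
      fun k _ => subset_convexHull ℝ _ (Set.mem_range_self k))
  have h0 := Polynomial.eq_zero_of_infinite_isRoot F (infinite_of_mem_nhds 0 hroot)
  have h1 := hF 1
  simpa [h0, W] using h1.symm

lemma dotProduct_sub_eq_eval (a : V3) (c : ℝ) (y z : V3) :
    a ⬝ᵥ (y - z) = eval y (affPoly a c) - eval z (affPoly a c) := by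
  rw [dotProduct_sub, eval_affPoly, eval_affPoly, dotProduct, dotProduct]
  ring

lemma exists_unit_smul {a : V3} (ha : a ≠ 0) : ∃ ρ : ℝ, ρ ≠ 0 ∧ (ρ • a) ⬝ᵥ (ρ • a) = 1 := by
  have h0 : 0 < a ⬝ᵥ a := lt_of_le_of_ne
    (Finset.sum_nonneg fun d _ => mul_self_nonneg (a d))
    (Ne.symm (dotProduct_self_eq_zero.not.2 ha))
  refine ⟨(Real.sqrt (a ⬝ᵥ a))⁻¹, inv_ne_zero (Real.sqrt_pos.2 h0).ne', ?_⟩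
  rw [dotProduct_smul, smul_dotProduct, smul_eq_mul, smul_eq_mul, ← mul_assoc, ← mul_inv,
    Real.mul_self_sqrt h0.le, inv_mul_cancel₀ h0.ne']

lemma eval_affPoly_eq_zero_of_mem_convexHull {a : V3} {c : ℝ} {S : Set V3}
    (hS : ∀ y ∈ S, eval y (affPoly a c) = 0) {y : V3} (hy : y ∈ convexHull ℝ S) :
    eval y (affPoly a c) = 0 := by
  refine convexHull_min (t := {y | eval y (affPoly a c) = 0}) hS ?_ hy
  intro u hu v hv s t _ _ hst
  simp only [Set.mem_ofPred_eq, eval_affPoly, Fin.sum_univ_three, Pi.add_apply, Pi.smul_apply,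
    smul_eq_mul] at *
  linear_combination s * hu + t * hv - c * hst

namespace IsBaryCoords

variable {x a : Fin 4 → V3} {c : Fin 4 → ℝ}

lemma affPoly_dvd_of_eval_bdryFace (H : IsBaryCoords x a c) (i : Fin 4) {f : P3}
    (h : ∀ y ∈ bdryFace x i, eval y f = 0) : affPoly (a i) (c i) ∣ f := by
  refine affPoly_dvd_of_eval (H.grad_ne_zero i) fun y hy => ?_
  have h1 := H.combination_eval y
  have h2 := H.sum_eval y
  rw [Fin.sum_univ_succAbove _ i, hy] at h1 h2
  rw [zero_smul, zero_add] at h1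
  rw [zero_add] at h2
  rw [← h1]
  refine eval_eq_zero_of_convexHull (P := fun k => x (i.succAbove k)) (fun y hy => h y ?_) h2
  refine convexHull_mono ?_ hy
  rintro _ ⟨k, rfl⟩
  exact ⟨_, Fin.succAbove_ne i k, rfl⟩

lemma affPoly_sub_dvd_of_eval_intFace (H : IsBaryCoords x a c) {i j : Fin 4} (hij : i ≠ j)
    {f : P3} (h : ∀ y ∈ intFace x i j, eval y f = 0) :
    affPoly (a i) (c i) - affPoly (a j) (c j) ∣ f := by
  rw [affPoly_sub]
  refine affPoly_dvd_of_eval (H.grad_sub_ne_zero hij) fun y hy => ?_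
  rw [← affPoly_sub, map_sub, sub_eq_zero] at hy
  have h1 := H.combination_eval y
  have h2 := H.sum_eval y
  generalize hl : (fun k => eval y (affPoly (a k) (c k))) = l at *
  replace hl : ∀ k, eval y (affPoly (a k) (c k)) = l k := congrFun hl
  simp only [hl] at h1 h2 hy
  have hcard : ∀ i j : Fin 4, i ≠ j → (Finset.univ.filter fun k => k = i ∨ k = j).card = 2 := by
    decide
  let P : Fin 4 → V3 := fun k => if k = i ∨ k = j then bary x else x k
  let w : Fin 4 → ℝ := fun k => l k - l i + if k = i ∨ k = j then 2 * l i else 0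
  have hw : ∑ k, w k = 1 := by
    simp only [w, Finset.sum_add_distrib, Finset.sum_sub_distrib, h2, Finset.sum_ite,
      Finset.sum_const, hcard i j hij]
    simp
    ring
  have hwP : ∑ k, w k • P k = y := by
    have : ∀ k, w k • P k =
        l k • x k - l i • x k + if k = i ∨ k = j then (2 * l i) • bary x else 0 := by
      intro k
      by_cases hk : k = i ∨ k = j
      · have : l k = l i := by rcases hk with rfl | rfl <;> simp [hy]
        simp [w, P, hk, this]
      · simp [w, P, hk, sub_smul]
    simp only [this, Finset.sum_add_distrib, Finset.sum_sub_distrib, h1, Finset.sum_ite,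
      Finset.sum_const, hcard i j hij, ← Finset.smul_sum]
    funext d
    simp [bary, Fin.sum_univ_four]
    ring
  rw [← hwP]
  refine eval_eq_zero_of_convexHull (fun y hy => h y ?_) hw
  refine convexHull_mono ?_ hy
  rintro _ ⟨k, rfl⟩
  by_cases hk : k = i ∨ k = j
  · simp [P, hk]
  · exact Or.inr ⟨k, not_or.1 hk, (if_neg hk).symm⟩

lemma eval_eq_zero_of_mem_bdryFace (H : IsBaryCoords x a c) {i : Fin 4} {y : V3}
    (hy : y ∈ bdryFace x i) : eval y (affPoly (a i) (c i)) = 0 := by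
  refine eval_affPoly_eq_zero_of_mem_convexHull ?_ hy
  rintro _ ⟨k, hk, rfl⟩
  rw [H.vertex, if_neg (Ne.symm hk)]

lemma eval_sub_eq_zero_of_mem_intFace (H : IsBaryCoords x a c) {i j : Fin 4} {y : V3}
    (hy : y ∈ intFace x i j) : eval y (affPoly (a i) (c i) - affPoly (a j) (c j)) = 0 := by
  rw [affPoly_sub]
  refine eval_affPoly_eq_zero_of_mem_convexHull ?_ hy
  rintro _ (rfl | ⟨k, ⟨hi, hj⟩, rfl⟩)
  · rw [← affPoly_sub, map_sub, H.eval_bary, H.eval_bary, sub_self]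
  · rw [← affPoly_sub, map_sub, H.vertex, H.vertex, if_neg hi.symm, if_neg hj.symm, sub_self]

lemma affPoly_dvd_of_normal (H : IsBaryCoords x a c) {i : Fin 4} {v : VP3}
    (h : ∀ n, IsUnitNormalBdry x i n → ∀ y ∈ bdryFace x i, evalV v y ⬝ᵥ n = 0) :
    affPoly (a i) (c i) ∣ ∑ d, v d * C (a i d) := by
  obtain ⟨ρ, hρ, hunit⟩ := exists_unit_smul (H.grad_ne_zero i)
  refine H.affPoly_dvd_of_eval_bdryFace i fun y hy => ?_
  have := h (ρ • a i) ⟨hunit, fun j k hj hk => ?_⟩ y hy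
  · rw [dotProduct_smul, smul_eq_mul] at this
    simpa [dotProduct, evalV] using (mul_eq_zero.1 this).resolve_left hρ
  · rw [smul_dotProduct, dotProduct_sub_eq_eval _ (c i), H.vertex, H.vertex, if_neg hj.symm,
      if_neg hk.symm, sub_self, smul_zero]

lemma affPoly_sub_dvd_of_normal (H : IsBaryCoords x a c) {i j : Fin 4} (hij : i ≠ j) {u v : VP3}
    (h : ∀ n, IsUnitNormalInt x i j n → ∀ y ∈ intFace x i j, (evalV u y - evalV v y) ⬝ᵥ n = 0) :
    affPoly (a i) (c i) - affPoly (a j) (c j) ∣ ∑ d, (u d - v d) * C (a i d - a j d) := by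
  obtain ⟨ρ, hρ, hunit⟩ := exists_unit_smul (H.grad_sub_ne_zero hij)
  refine H.affPoly_sub_dvd_of_eval_intFace hij fun y hy => ?_
  have := h (ρ • (a i - a j)) ⟨hunit, fun k hi hj => ?_⟩ y hy
  · rw [dotProduct_smul, smul_eq_mul] at this
    simpa [dotProduct, evalV] using (mul_eq_zero.1 this).resolve_left hρ
  · rw [smul_dotProduct, dotProduct_sub_eq_eval _ (c i - c j), ← affPoly_sub, map_sub, map_sub,
      H.vertex, H.vertex, H.eval_bary, H.eval_bary, if_neg hi.symm, if_neg hj.symm]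
    simp

end IsBaryCoords

end Alfeld

/-- divergence-free piecewise polynomial vector fields on an Alfeld split with
single-valued normal traces on interior faces and vanishing normal trace on the boundary
are curls of continuous piecewise polynomial vector fields vanishing on the boundary. -/
theorem statement1 (r : ℕ) (x : Fin 4 → V3) (hx : AffineIndependent ℝ x)
    (p : Fin 4 → VP3) (hdeg : ∀ i, degVle (p i) r)
    (hnormInt : ∀ i j, i ≠ j → ∀ n, IsUnitNormalInt x i j n →
      ∀ y ∈ intFace x i j, (evalV (p i) y - evalV (p j) y) ⬝ᵥ n = 0)
    (hnormBdry : ∀ i, ∀ n, IsUnitNormalBdry x i n →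
      ∀ y ∈ bdryFace x i, evalV (p i) y ⬝ᵥ n = 0)
    (hdiv : ∀ i, pdiv (p i) = 0) :
    ∃ q : Fin 4 → VP3,
      (∀ i, degVle (q i) (r + 1)) ∧
      (∀ i j, i ≠ j → ∀ y ∈ intFace x i j, evalV (q i) y = evalV (q j) y) ∧
      (∀ i, ∀ y ∈ bdryFace x i, evalV (q i) y = 0) ∧
      (∀ i, pcurl (q i) = p i) := by
  obtain ⟨a, c, H⟩ := exists_isBaryCoords hx
  obtain ⟨Q, hQdeg, hQcont, hQ⟩ := H.exists_potential r 0 p hdeg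
    (fun i => H.affPoly_dvd_of_normal (hnormBdry i))
    (fun i j hij => H.affPoly_sub_dvd_of_normal hij (hnormInt i j hij))
    (fun i => by simpa using hdiv i)
  refine ⟨fun i d => affPoly (a i) (c i) * Q i d, fun i d => ?_, fun i j hij y hy => ?_,
    fun i y hy => ?_, fun i => ?_⟩
  · refine (totalDegree_mul _ _).trans ?_
    rw [add_comm]
    exact add_le_add (hQdeg i d) (totalDegree_affPoly_le _ _)
  · have hL := H.eval_sub_eq_zero_of_mem_intFace hy
    funext d
    have hd := eval_eq_zero_of_dvd (hQcont i j d) hL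
    rw [map_sub, sub_eq_zero] at hL hd
    simp only [evalV, map_mul, hL, hd]
  · funext d
    simp [evalV, H.eval_eq_zero_of_mem_bdryFace hy]
  · simpa using hQ i
end
end

section
/- Let r ≥ 0 be an integer. Suppose (p₀,p₁,p₂,p₃) is a piecewise polynomial scalar field of degree ≤ r on the Alfeld split T^z of a tetrahedron T ⊂ ℝ³ with vanishing mean, i.e. ∑_{i=0}^{3} ∫_{T_i} p_i dx = 0. Then there exists a piecewise polynomial vector field (q₀,q₁,q₂,q₃) of degree ≤ r+1 on T^z which is continuous across interior faces (q_i = q_j on F_{ij} for all i ≠ j), vanishes on the boundary of T (q_i = 0 on F_i for each i), and satisfies div q_i = p_i for each i. -/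
open MvPolynomial Matrix

noncomputable section

open Alfeld

namespace Alfeld

open MeasureTheory

/-- The polynomial representing a barycentric coordinate. -/
def coordPoly (b : AffineBasis (Fin 4) ℝ V3) (i : Fin 4) : P3 :=
  C (b.coord i 0) + ∑ c, C ((b.coord i).linear (Pi.single c 1)) * X c

/-- The derivative of polynomials along a constant vector. -/
def dirDeriv (v : V3) : Derivation ℝ P3 P3 := ∑ c, v c • pderiv c

theorem dirDeriv_apply (v : V3) (q : P3) : dirDeriv v q = ∑ c, C (v c) * pderiv c q := by
  simp [dirDeriv, Fin.sum_univ_three, smul_eq_C_mul]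

theorem pdiv_smul_const (v : V3) (q : P3) : pdiv (fun c => C (v c) * q) = dirDeriv v q := by
  simp [pdiv, dirDeriv_apply]

theorem totalDegree_pderiv_le_s2 {q : P3} {d : ℕ} (h : q.totalDegree ≤ d + 1) (c : Fin 3) :
    (pderiv c q).totalDegree ≤ d := by
  rw [q.as_sum, map_sum]
  refine totalDegree_finsetSum_le fun s hs => ?_
  rw [pderiv_monomial]
  by_cases h0 : s c = 0
  · simp [h0]
  refine (totalDegree_monomial_le _ _).trans ?_
  have h1 := (le_totalDegree hs).trans h
  have h2 : Finsupp.single c 1 ≤ s := by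
    simpa using Nat.one_le_iff_ne_zero.2 h0
  have h3 : ((s - Finsupp.single c 1) + Finsupp.single c 1).sum (fun _ e => e) ≤ d + 1 := by
    rwa [tsub_add_cancel_of_le h2]
  rw [Finsupp.sum_add_index' (by simp) (by simp), Finsupp.sum_single_index rfl] at h3
  exact Nat.le_of_succ_le_succ h3

theorem totalDegree_dirDeriv_le {q : P3} {d : ℕ} (h : q.totalDegree ≤ d + 1) (v : V3) :
    (dirDeriv v q).totalDegree ≤ d := by
  rw [dirDeriv_apply]
  refine totalDegree_finsetSum_le fun c _ => (totalDegree_mul _ _).trans ?_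
  simpa using totalDegree_pderiv_le_s2 h c

theorem hasLineDerivAt_eval (q : P3) (y v : V3) :
    HasLineDerivAt ℝ (fun y => eval y q) (eval y (dirDeriv v q)) y v := by
  unfold HasLineDerivAt
  induction q using MvPolynomial.induction_on with
  | C a => simpa [dirDeriv_apply] using hasDerivAt_const (0 : ℝ) a
  | add p q hp hq =>
    simp only [map_add]
    exact hp.fun_add hq
  | mul_X p c hp =>
    have hX : HasDerivAt (fun t : ℝ => y c + t * v c) (v c) 0 := by
      simpa using ((hasDerivAt_id (0 : ℝ)).mul_const (v c)).const_add (y c)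
    have h := hp.fun_mul hX
    have e : dirDeriv v (X c) = C (v c) := by
      rw [dirDeriv_apply]
      simp only [pderiv_X, Pi.single_apply]
      simp
    simp only [Derivation.leibniz, e, smul_eq_mul, map_add, map_mul, eval_X, eval_C]
    refine h.congr_deriv ?_
    simp only [zero_smul, add_zero, zero_mul]
    ring

section coordPoly

variable (b : AffineBasis (Fin 4) ℝ V3)

theorem eval_coordPoly (i : Fin 4) (y : V3) : eval y (coordPoly b i) = b.coord i y := by
  have h := (b.coord i).decomp
  rw [h]
  have hy : y = ∑ c, y c • (Pi.single c 1 : V3) := by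
    ext d; simp [Finset.sum_apply, Pi.single_apply]
  simp only [coordPoly, map_add, eval_C, map_sum, map_mul, eval_X, Pi.add_apply]
  conv_rhs => rw [hy]
  simp only [map_sum, map_smul, smul_eq_mul]
  rw [add_comm]
  congr 1
  exact Finset.sum_congr rfl fun _ _ => mul_comm _ _

theorem totalDegree_coordPoly_le (i : Fin 4) : (coordPoly b i).totalDegree ≤ 1 := by
  refine (totalDegree_add _ _).trans (max_le (by simp) ?_)
  refine totalDegree_finsetSum_le fun c _ => (totalDegree_mul _ _).trans ?_
  rw [totalDegree_C, totalDegree_X]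

theorem dirDeriv_coordPoly (i j k : Fin 4) :
    dirDeriv (b j - b k) (coordPoly b i) = C ((if i = j then 1 else 0) - if i = k then 1 else 0) := by
  have h : dirDeriv (b j - b k) (coordPoly b i) = C ((b.coord i).linear (b j - b k)) := by
    have hy : b j - b k = ∑ c, (b j - b k) c • (Pi.single c 1 : V3) := by
      ext d; simp [Finset.sum_apply, Pi.single_apply]
    conv_rhs => rw [hy]
    rw [dirDeriv_apply]
    simp only [coordPoly, map_add, map_sum, pderiv_C, pderiv_C_mul, pderiv_X, map_smul, map_mul,
      smul_eq_mul, Pi.single_apply]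
    simp
  rw [h, ← vsub_eq_sub, AffineMap.linearMap_vsub, AffineBasis.coord_apply, AffineBasis.coord_apply,
    vsub_eq_sub]

theorem sum_coordPoly : ∑ i, coordPoly b i = 1 := by
  refine MvPolynomial.funext fun y => ?_
  simp [eval_coordPoly]

theorem sum_C_mul_coordPoly (c : Fin 3) : ∑ i, C (b i c) * coordPoly b i = X c := by
  refine MvPolynomial.funext fun y => ?_
  have := congrFun (b.linear_combination_coord_eq_self y) c
  simpa [eval_coordPoly, Finset.sum_apply, mul_comm] using this

/-- A polynomial of degree at most `d + 1` is a combination of the barycentric coordinates with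
coefficients of degree at most `d`. -/
theorem exists_eq_sum_coordPoly_mul {d : ℕ} {q : P3} (h : q.totalDegree ≤ d + 1) :
    ∃ a : Fin 4 → P3, (∀ k, (a k).totalDegree ≤ d) ∧ q = ∑ k, coordPoly b k * a k := by
  have key : ∀ s ∈ q.support, ∃ a : Fin 4 → P3, (∀ k, (a k).totalDegree ≤ d) ∧
      monomial s (coeff s q) = ∑ k, coordPoly b k * a k := by
    intro s hs
    have h1 := (le_totalDegree hs).trans h
    by_cases h0 : s = 0
    · refine ⟨fun _ => C (coeff s q), by simp, ?_⟩
      rw [← Finset.sum_mul, sum_coordPoly, h0, one_mul]; rfl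
    · obtain ⟨c, hc⟩ := Finsupp.ne_iff.1 h0
      have h2 : Finsupp.single c 1 ≤ s := by
        simpa using Nat.one_le_iff_ne_zero.2 hc
      have h3 : ((s - Finsupp.single c 1) + Finsupp.single c 1).sum (fun _ e => e) ≤ d + 1 := by
        rwa [tsub_add_cancel_of_le h2]
      rw [Finsupp.sum_add_index' (by simp) (by simp), Finsupp.sum_single_index rfl] at h3
      refine ⟨fun k => C (b k c) * monomial (s - Finsupp.single c 1) (coeff s q), fun k => ?_, ?_⟩
      · refine (totalDegree_mul _ _).trans ?_
        rw [totalDegree_C, zero_add]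
        exact (totalDegree_monomial_le _ _).trans (Nat.le_of_succ_le_succ h3)
      · calc monomial s (coeff s q) = X c * monomial (s - Finsupp.single c 1) (coeff s q) := by
              rw [X, monomial_mul, add_tsub_cancel_of_le h2, one_mul]
          _ = _ := by
              rw [← sum_C_mul_coordPoly b c, Finset.sum_mul]
              exact Finset.sum_congr rfl fun _ _ => by ring
  choose! a ha using key
  refine ⟨fun k => ∑ s ∈ q.support, a s k,
    fun k => totalDegree_finsetSum_le fun s hs => (ha s hs).1 k, ?_⟩
  simp only [Finset.mul_sum]
  rw [Finset.sum_comm]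
  conv_lhs => rw [q.as_sum]
  exact Finset.sum_congr rfl fun s hs => (ha s hs).2

end coordPoly

section generation

variable (b : AffineBasis (Fin 4) ℝ V3)

theorem dirDeriv_coordPoly_pow_mul (i j k : Fin 4) (n : ℕ) (A : P3) :
    dirDeriv (b j - b k) (coordPoly b i ^ (n + 1) * A) =
      coordPoly b i ^ n * (C (((n : ℝ) + 1) * ((if i = j then 1 else 0) - if i = k then 1 else 0)) * A) +
        coordPoly b i ^ (n + 1) * dirDeriv (b j - b k) A := by
  rw [Derivation.leibniz, Derivation.leibniz_pow, dirDeriv_coordPoly]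
  simp only [smul_eq_mul, nsmul_eq_mul, C_mul, C_add, map_natCast, C_1, add_tsub_cancel_right]
  push_cast
  ring

/-- Modulo derivatives of fields vanishing on the boundary, every piecewise polynomial reduces to
a power of the hat function of the barycenter on a single piece. -/
theorem mem_of_dirDeriv_mem {r : ℕ} (B : Submodule ℝ (Fin 4 → P3))
    (hgen : ∀ (n : ℕ) (A : P3), A.totalDegree + n ≤ r → ∀ j k,
      (fun i => dirDeriv (b j - b k) (coordPoly b i ^ (n + 1) * A)) ∈ B)
    (hE : Pi.single 0 (coordPoly b 0 ^ r) ∈ B) {d s : ℕ} (hds : d + s = r)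
    (p : Fin 4 → P3) (hp : ∀ i, (p i).totalDegree ≤ d) :
    (fun i => coordPoly b i ^ s * p i) ∈ B := by
  induction d generalizing s p with
  | zero =>
    obtain rfl : s = r := by simpa using hds
    have h1 : ∀ i, Pi.single i (coordPoly b i ^ s) ∈ B := by
      intro i
      have h := B.add_mem (B.smul_mem ((s + 1 : ℝ)⁻¹) (hgen s 1 (by simp) i 0)) hE
      convert h using 1
      funext j
      have hs : (s + 1 : ℝ) ≠ 0 := by positivity
      simp only [Pi.add_apply, Pi.smul_apply, dirDeriv_coordPoly_pow_mul, Derivation.map_one_eq_zero,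
        mul_zero, add_zero, smul_eq_C_mul]
      rw [mul_one, mul_left_comm, ← C_mul, inv_mul_cancel_left₀ hs]
      by_cases hi : j = i <;> by_cases h0 : j = 0
      · subst hi; subst h0; simp
      · subst hi; simp [h0]
      · subst h0; simp [hi]
      · simp [hi, h0]
    have h2 : (fun i => coordPoly b i ^ s * p i) =
        ∑ i, coeff 0 (p i) • (Pi.single i (coordPoly b i ^ s) : Fin 4 → P3) := by
      funext j
      have hj : p j = C (coeff 0 (p j)) := totalDegree_eq_zero_iff_eq_C.1 (by simpa using hp j)
      simp only [Finset.sum_apply, Pi.smul_apply]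
      rw [Finset.sum_eq_single j (fun k _ hk => by simp [hk.symm]) (by simp), Pi.single_eq_same,
        smul_eq_C_mul, ← hj, mul_comm]
    rw [h2]
    exact B.sum_mem fun i _ => B.smul_mem _ (h1 i)
  | succ d ih =>
    have hds' : d + (s + 1) = r := by omega
    have hprod : ∀ i k (a : P3), k ≠ i → a.totalDegree ≤ d →
        Pi.single i (coordPoly b i ^ s * ((coordPoly b k - coordPoly b i) * a)) ∈ B := by
      intro i k a hki ha
      have hq : ∀ j, ((coordPoly b k - coordPoly b j) * a).totalDegree ≤ d + 1 := fun j => by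
        refine (totalDegree_mul _ _).trans ?_
        have := totalDegree_sub (coordPoly b k) (coordPoly b j)
        have := max_le (totalDegree_coordPoly_le b k) (totalDegree_coordPoly_le b j)
        omega
      have h1 := hgen s (coordPoly b k * a) (by
        have := totalDegree_mul (coordPoly b k) a
        have := totalDegree_coordPoly_le b k
        omega) i k
      have h2 := hgen (s + 1) a (by omega) i k
      have h3 := ih hds' (fun j => dirDeriv (b i - b k) ((coordPoly b k - coordPoly b j) * a))
        fun j => totalDegree_dirDeriv_le (hq j) _
      convert B.smul_mem ((s + 1 : ℝ)⁻¹) (B.sub_mem (B.sub_mem h1 h2) h3) using 1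
      funext j
      have hs : (s + 1 : ℝ) ≠ 0 := by positivity
      have h4 : dirDeriv (b i - b k) (coordPoly b j ^ (s + 1) * (coordPoly b k * a)) -
          dirDeriv (b i - b k) (coordPoly b j ^ (s + 1 + 1) * a) =
          dirDeriv (b i - b k) (coordPoly b j ^ (s + 1) * ((coordPoly b k - coordPoly b j) * a)) := by
        rw [← map_sub]
        congr 1
        ring
      simp only [Pi.sub_apply, Pi.smul_apply]
      rw [h4, dirDeriv_coordPoly_pow_mul, add_sub_cancel_right, smul_eq_C_mul,
        mul_left_comm (C (s + 1 : ℝ)⁻¹), ← mul_assoc (C (s + 1 : ℝ)⁻¹), ← C_mul,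
        inv_mul_cancel_left₀ hs]
      by_cases hi : j = i
      · subst hi; simp [hki.symm]
      · by_cases hk : j = k
        · subst hk; simp [hi]
        · simp [hi, hk]
    have hsingle : ∀ i, Pi.single i (coordPoly b i ^ s * p i) ∈ B := by
      intro i
      obtain ⟨a, ha, hpa⟩ := exists_eq_sum_coordPoly_mul b (hp i)
      have h1 : coordPoly b i ^ s * p i = coordPoly b i ^ (s + 1) * ∑ k, a k +
          ∑ k ∈ Finset.univ.erase i,
            coordPoly b i ^ s * ((coordPoly b k - coordPoly b i) * a k) := by
        rw [Finset.sum_erase _ (by simp), hpa]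
        simp only [Finset.mul_sum, ← Finset.sum_add_distrib]
        exact Finset.sum_congr rfl fun _ _ => by ring
      rw [h1, Pi.single_add]
      refine B.add_mem ?_ ?_
      · convert ih hds' (Pi.single i (∑ k, a k)) (fun j => ?_) using 1
        · funext j
          by_cases hj : j = i
          · subst hj; simp
          · simp [hj]
        · by_cases hj : j = i
          · subst hj
            simpa using totalDegree_finsetSum_le fun k _ => ha k
          · simp [hj]
      · rw [show Pi.single i (∑ k ∈ Finset.univ.erase i, _) = ∑ k ∈ Finset.univ.erase i, _ from
          map_sum (LinearMap.single ℝ (fun _ => P3) i) _ _]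
        exact B.sum_mem fun k hk => hprod i k (a k) (Finset.ne_of_mem_erase hk) (ha k)
    rw [← Finset.univ_sum_single (fun i => coordPoly b i ^ s * p i)]
    exact B.sum_mem fun i _ => hsingle i

end generation

section geometry

variable (b : AffineBasis (Fin 4) ℝ V3)

theorem coord_bary (k : Fin 4) : b.coord k (bary b) = 4⁻¹ := by
  have h1 := b.coord_apply_combination_of_mem (s := Finset.univ) (Finset.mem_univ k)
    (w := fun _ => (4 : ℝ)⁻¹) (by simp)
  rw [Finset.affineCombination_eq_linear_combination _ _ _ (by simp), ← Finset.smul_sum,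
    Fin.sum_univ_four] at h1
  exact h1

theorem convex_setOf_coord_le (i : Fin 4) :
    Convex ℝ {y | 0 ≤ b.coord i y ∧ ∀ k, b.coord i y ≤ b.coord k y} := by
  intro u hu w hw s t hs ht hst
  simp only [Set.mem_ofPred_eq, Convex.combo_affine_apply hst, smul_eq_mul]
  refine ⟨add_nonneg (mul_nonneg hs hu.1) (mul_nonneg ht hw.1), fun k => ?_⟩
  exact add_le_add (mul_le_mul_of_nonneg_left (hu.2 k) hs) (mul_le_mul_of_nonneg_left (hw.2 k) ht)

theorem mem_piece_iff {i : Fin 4} {y : V3} :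
    y ∈ piece b i ↔ 0 ≤ b.coord i y ∧ ∀ k, b.coord i y ≤ b.coord k y := by
  constructor
  · intro hy
    refine convexHull_min ?_ (convex_setOf_coord_le b i) hy
    rintro _ (rfl | ⟨j, hj, rfl⟩)
    · simp [coord_bary]
    · have : i ≠ j := Ne.symm hj
      simp only [Set.mem_ofPred_eq, b.coord_apply_ne this]
      refine ⟨le_rfl, fun k => ?_⟩
      rw [b.coord_apply]
      split_ifs <;> simp
  · rintro ⟨h0, h⟩
    have hsum := b.sum_coord_apply_eq_one y
    have hy := b.linear_combination_coord_eq_self y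
    have key : ∑ k, (b.coord k y - b.coord i y + if k = i then 4 * b.coord i y else 0) •
        (if k = i then bary b else b k) = y := by
      conv_rhs => rw [← hy]
      have hz : (4 : ℝ) • bary b = ∑ k, b k := by
        rw [bary, smul_inv_smul₀ (by norm_num), Fin.sum_univ_four]
      have : ∀ k, (b.coord k y - b.coord i y + if k = i then 4 * b.coord i y else 0) •
          (if k = i then bary b else b k) = b.coord k y • b k - b.coord i y • b k +
            if k = i then b.coord i y • (4 : ℝ) • bary b else 0 := by
        intro k
        split_ifs with hk
        · subst hk; module
        · module
      simp only [this, Finset.sum_add_distrib, Finset.sum_sub_distrib, Finset.sum_ite_eq',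
        Finset.mem_univ, if_true, hz, ← Finset.smul_sum, sub_add_cancel]
    rw [← key]
    refine (convex_convexHull ℝ _).sum_mem (fun k _ => ?_) ?_ fun k _ => subset_convexHull ℝ _ ?_
    · have := h k
      split_ifs <;> linarith
    · simp [Finset.sum_add_distrib, Finset.sum_sub_distrib, hsum]
    · split_ifs with hk
      · exact Set.mem_insert _ _
      · exact Set.mem_insert_of_mem _ ⟨k, hk, rfl⟩

theorem coord_eq_of_mem_intFace {i j : Fin 4} {y : V3} (hy : y ∈ intFace b i j) :
    b.coord i y = b.coord j y := by
  have hi : intFace b i j ⊆ piece b i := convexHull_mono <| Set.insert_subset_insert <|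
    Set.image_mono fun k hk => hk.1
  have hj : intFace b i j ⊆ piece b j := convexHull_mono <| Set.insert_subset_insert <|
    Set.image_mono fun k hk => hk.2
  exact le_antisymm (((mem_piece_iff b).1 (hi hy)).2 j) (((mem_piece_iff b).1 (hj hy)).2 i)

theorem coord_eq_zero_of_mem_bdryFace {i : Fin 4} {y : V3} (hy : y ∈ bdryFace b i) :
    b.coord i y = 0 := by
  have hc : Convex ℝ {y | b.coord i y = 0} := by
    intro u hu w hw s t _ _ hst
    simp_all [Convex.combo_affine_apply hst]
  refine convexHull_min ?_ hc hy
  rintro _ ⟨j, hj, rfl⟩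
  exact b.coord_apply_ne (Ne.symm hj)

theorem isCompact_piece (x : Fin 4 → V3) (i : Fin 4) : IsCompact (piece x i) :=
  (((Set.toFinite _).image x).insert _).isCompact_convexHull ℝ

theorem continuous_eval (q : P3) : Continuous fun y => eval y q :=
  MvPolynomial.continuous_eval q

theorem continuous_coord (i : Fin 4) : Continuous (b.coord i) :=
  (b.coord i).continuous_of_finiteDimensional

theorem exists_lipschitzWith_coord (i : Fin 4) : ∃ K, LipschitzWith K (b.coord i) := by
  refine ⟨‖LinearMap.toContinuousLinearMap (b.coord i).linear‖₊, fun y z => ?_⟩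
  have h := (LinearMap.toContinuousLinearMap (b.coord i).linear).lipschitz y z
  rw [(b.coord i).decomp]
  simpa using h

theorem volume_setOf_eq_zero (f : V3 →ᵃ[ℝ] ℝ) {u : V3} (hu : f u ≠ 0) :
    volume {y | f y = 0} = 0 := by
  have h := Measure.addHaar_affineSubspace volume ((AffineSubspace.mk' (0 : ℝ) ⊥).comap f)
    (fun h => hu <| by
      have : u ∈ (AffineSubspace.mk' (0 : ℝ) ⊥).comap f := h ▸ AffineSubspace.mem_top ℝ V3 u
      simpa using this)
  convert h using 2
  ext y
  simp

theorem ae_coord_ne : ∀ᵐ y : V3, (∀ k, b.coord k y ≠ 0) ∧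
    ∀ k l, k ≠ l → b.coord k y ≠ b.coord l y := by
  refine Filter.Eventually.and ?_ ?_
  · refine ae_all_iff.2 fun k => ?_
    simpa [ae_iff] using volume_setOf_eq_zero (b.coord k) (u := b k) (by simp)
  · refine ae_all_iff.2 fun k => ae_all_iff.2 fun l => ?_
    by_cases hkl : k = l
    · simp [hkl]
    · simpa [ae_iff, hkl, sub_eq_zero] using
        volume_setOf_eq_zero (b.coord k - b.coord l) (u := b k) (by simp [Ne.symm hkl])

/-- One quarter of the piecewise linear hat function of the barycenter, extended by zero. -/
def hat (y : V3) : ℝ :=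
  max 0 (min (min (b.coord 0 y) (b.coord 1 y)) (min (b.coord 2 y) (b.coord 3 y)))

theorem hat_eq_coord {j : Fin 4} {y : V3} (h0 : 0 ≤ b.coord j y)
    (h : ∀ k, b.coord j y ≤ b.coord k y) : hat b y = b.coord j y := by
  refine le_antisymm (max_le h0 ?_)
    (le_max_of_le_right (le_min (le_min (h 0) (h 1)) (le_min (h 2) (h 3))))
  fin_cases j <;> simp

theorem hat_eq_zero {k : Fin 4} {y : V3} (h : b.coord k y < 0) : hat b y = 0 := by
  refine max_eq_left (le_trans ?_ h.le)
  fin_cases k <;> simp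

theorem exists_lipschitzWith_hat : ∃ K, LipschitzWith K (hat b) := by
  choose K hK using exists_lipschitzWith_coord b
  exact ⟨_, (LipschitzWith.const 0).max (((hK 0).min (hK 1)).min ((hK 2).min (hK 3)))⟩

theorem isCompact_convexHull_range (x : Fin 4 → V3) : IsCompact (convexHull ℝ (Set.range x)) :=
  (Set.finite_range x).isCompact_convexHull ℝ

theorem hat_eq_zero_of_notMem {y : V3} (hy : y ∉ convexHull ℝ (Set.range b)) : hat b y = 0 := by
  rw [b.convexHull_eq_nonneg_coord] at hy
  simp only [Set.mem_ofPred_eq, not_forall, not_le] at hy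
  obtain ⟨k, hk⟩ := hy
  exact hat_eq_zero b hk

/-- A product with a Lipschitz function vanishing off a compact set is Lipschitz as soon as the
other factor is Lipschitz on that set. -/
theorem exists_lipschitzWith_mul {E : Type*} [PseudoMetricSpace E] {s : Set E} {f g : E → ℝ}
    {K L : NNReal} (hs : IsCompact s) (hf : LipschitzWith K f) (hfs : ∀ y ∉ s, f y = 0)
    (hg : LipschitzOnWith L g s) : ∃ M, LipschitzWith M fun y => f y * g y := by
  obtain ⟨a, ha⟩ := hs.exists_bound_of_continuousOn hf.continuous.continuousOn
  obtain ⟨c, hc⟩ := hs.exists_bound_of_continuousOn hg.continuousOn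
  have key : ∀ y ∈ s, ∀ z, |f y * g y - f z * g z| ≤
      (K * c.toNNReal + L * a.toNNReal : NNReal) * dist y z := by
    intro y hy z
    have h1 := hf.dist_le_mul y z
    have h2 := (hc y hy).trans (Real.le_coe_toNNReal c)
    rw [Real.dist_eq] at h1
    rw [Real.norm_eq_abs] at h2
    have h3 : |(f y - f z) * g y| ≤ K * c.toNNReal * dist y z := by
      rw [abs_mul]
      calc _ ≤ (K * dist y z) * c.toNNReal := by gcongr
        _ = _ := by ring
    have h4 : |f z * (g y - g z)| ≤ L * a.toNNReal * dist y z := by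
      by_cases hz : z ∈ s
      · have h5 := hg.dist_le_mul y hy z hz
        have h6 := (ha z hz).trans (Real.le_coe_toNNReal a)
        rw [Real.dist_eq] at h5
        rw [Real.norm_eq_abs] at h6
        rw [abs_mul]
        calc _ ≤ a.toNNReal * (L * dist y z) := by gcongr
          _ = _ := by ring
      · rw [hfs z hz, zero_mul, abs_zero]
        positivity
    calc _ = |(f y - f z) * g y + f z * (g y - g z)| := by congr 1; ring
      _ ≤ _ := abs_add_le _ _
      _ ≤ _ := add_le_add h3 h4
      _ = _ := by push_cast; ring
  refine ⟨K * c.toNNReal + L * a.toNNReal, LipschitzWith.of_dist_le_mul fun y z => ?_⟩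
  by_cases hy : y ∈ s
  · exact key y hy z
  · by_cases hz : z ∈ s
    · rw [dist_comm, dist_comm y]
      exact key z hz y
    · simp only [hfs y hy, hfs z hz, zero_mul, dist_self]
      positivity

theorem exists_lipschitzWith_hat_pow_mul (n : ℕ) (A : P3) :
    ∃ K, LipschitzWith K fun y => hat b y ^ (n + 1) * eval y A := by
  have hT := isCompact_convexHull_range b
  obtain ⟨K, hK⟩ := exists_lipschitzWith_hat b
  have hz : ∀ y ∉ convexHull ℝ (Set.range b), hat b y = 0 := fun y => hat_eq_zero_of_notMem b
  induction n with
  | zero =>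
    have hA : ContDiff ℝ 1 fun y : V3 => eval y A := by
      induction A using MvPolynomial.induction_on with
      | C a => simpa using contDiff_const
      | add p q hp hq => simpa using hp.add hq
      | mul_X p c hp => simpa using hp.mul (contDiff_apply ℝ ℝ c)
    obtain ⟨L, hL⟩ := hA.contDiffOn.exists_lipschitzOnWith one_ne_zero (convex_convexHull ℝ _) hT
    simpa using exists_lipschitzWith_mul hT hK hz hL
  | succ n ih =>
    obtain ⟨L, hL⟩ := ih
    simpa [pow_succ' _ (n + 1), mul_assoc] using
      exists_lipschitzWith_mul hT hK hz (hL.lipschitzOnWith (s := convexHull ℝ (Set.range b)))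

/-- The divergence theorem for the product of a power of the hat function of the barycenter with
a polynomial, in a constant direction. -/
theorem sum_integral_dirDeriv_eq_zero (n : ℕ) (A : P3) (v : V3) :
    ∑ i, ∫ y in piece b i, eval y (dirDeriv v (coordPoly b i ^ (n + 1) * A)) = 0 := by
  set g : V3 → ℝ := fun y => hat b y ^ (n + 1) * eval y A with hg
  obtain ⟨K, hK⟩ := exists_lipschitzWith_hat_pow_mul b n A
  have hgc : HasCompactSupport g := HasCompactSupport.intro (isCompact_convexHull_range b)
    fun y hy => by simp [hg, hat_eq_zero_of_notMem b hy]
  have h0 : ∫ y, lineDeriv ℝ g y v = 0 := by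
    have h := LipschitzWith.integral_lineDeriv_mul_eq (μ := volume) (LipschitzWith.const (1 : ℝ)) hK hgc (-v)
    simpa [lineDeriv] using h.symm
  rw [← h0]
  have hm : ∀ i, MeasurableSet (piece b i) := fun i => (isCompact_piece b i).measurableSet
  simp only [← integral_indicator (hm _)]
  rw [← integral_finsetSum _ fun i _ => ((continuous_eval _).continuousOn.integrableOn_compact
    (isCompact_piece b i)).integrable_indicator (hm i)]
  refine integral_congr_ae ?_
  filter_upwards [ae_coord_ne b] with y hy
  by_cases hpos : ∃ k, b.coord k y < 0
  · obtain ⟨k, hk⟩ := hpos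
    have hev : g =ᶠ[nhds y] fun _ => 0 := by
      filter_upwards [(continuous_coord b k).continuousAt.eventually_lt continuousAt_const hk]
        with z hz
      simp [hg, hat_eq_zero b hz]
    rw [hev.lineDeriv_eq]
    simp only [lineDeriv, deriv_const]
    refine Finset.sum_eq_zero fun i _ => Set.indicator_of_notMem (fun hi => ?_) _
    have := (mem_piece_iff b).1 hi
    linarith [this.1, this.2 k]
  · push Not at hpos
    obtain ⟨j, hj⟩ := Finite.exists_min fun k => b.coord k y
    have hj0 : 0 < b.coord j y := lt_of_le_of_ne (hpos j) (hy.1 j).symm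
    have hlt : ∀ k, k ≠ j → b.coord j y < b.coord k y := fun k hk =>
      lt_of_le_of_ne (hj k) (hy.2 j k hk.symm)
    have hev : g =ᶠ[nhds y] fun z => eval z (coordPoly b j ^ (n + 1) * A) := by
      have h1 := continuousAt_const.eventually_lt (continuous_coord b j).continuousAt hj0
      have h2 : ∀ᶠ z in nhds y, ∀ k, k ≠ j → b.coord j z < b.coord k z :=
        Filter.eventually_all.2 fun k => by
          by_cases hk : k = j
          · simp [hk]
          · filter_upwards [(continuous_coord b j).continuousAt.eventually_lt
              (continuous_coord b k).continuousAt (hlt k hk)] with z hz _ using hz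
      filter_upwards [h1, h2] with z hz1 hz2
      have : hat b z = b.coord j z := hat_eq_coord b hz1.le fun k => by
        by_cases hk : k = j
        · rw [hk]
        · exact (hz2 k hk).le
      simp [hg, this, eval_coordPoly]
    rw [hev.lineDeriv_eq, (hasLineDerivAt_eval _ y v).lineDeriv, Finset.sum_eq_single j,
      Set.indicator_of_mem ((mem_piece_iff b).2 ⟨hj0.le, hj⟩)]
    · intro i _ hi
      refine Set.indicator_of_notMem (fun h => ?_) _
      exact absurd (((mem_piece_iff b).1 h).2 j) (hlt i hi).not_ge
    · simp

theorem integral_piece_coordPoly_pow_pos (i : Fin 4) (r : ℕ) :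
    0 < ∫ y in piece b i, eval y (coordPoly b i ^ r) := by
  have hm := (isCompact_piece b i).measurableSet
  rw [setIntegral_pos_iff_support_of_nonneg_ae]
  · let U : Set V3 := {y | 0 < b.coord i y} ∩ ⋂ k, {y | k ≠ i → b.coord i y < b.coord k y}
    have hU : IsOpen U := by
      refine (isOpen_lt continuous_const (continuous_coord b i)).inter
        (isOpen_iInter_of_finite fun k => ?_)
      by_cases hk : k = i
      · simp [hk]
      · simpa [hk] using isOpen_lt (continuous_coord b i) (continuous_coord b k)
    have hne : U.Nonempty := by
      let w : Fin 4 → ℝ := fun k => if k = i then 1 / 7 else 2 / 7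
      have hw : ∑ k, w k = 1 := by
        rw [Finset.sum_ite, Finset.sum_const, Finset.sum_const, Finset.filter_eq',
          Finset.filter_ne']
        simp
        norm_num
      have hc : ∀ k, b.coord k (Finset.univ.affineCombination ℝ b w) = w k := fun k =>
        b.coord_apply_combination_of_mem (Finset.mem_univ k) hw
      refine ⟨Finset.univ.affineCombination ℝ b w, ?_, Set.mem_iInter.2 fun k hk => ?_⟩
      · simp only [Set.mem_ofPred_eq, hc, w]
        norm_num
      · simp only [hc, w, hk]
        norm_num
    refine (hU.measure_pos volume hne).trans_le (measure_mono fun y hy => ?_)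
    simp only [U, Set.mem_inter_iff, Set.mem_iInter, Set.mem_ofPred_eq] at hy
    refine ⟨?_, (mem_piece_iff b).2 ⟨hy.1.le, fun k => ?_⟩⟩
    · simpa [eval_coordPoly] using fun h => absurd h hy.1.ne'
    · by_cases hk : k = i
      · rw [hk]
      · exact (hy.2 k hk).le
  · refine (ae_restrict_iff' hm).2 (Filter.Eventually.of_forall fun y hy => ?_)
    have := ((mem_piece_iff b).1 hy).1
    simpa [eval_coordPoly] using pow_nonneg this r
  · exact (continuous_eval _).continuousOn.integrableOn_compact (isCompact_piece b i)

end geometry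

section divergence

variable (x : Fin 4 → V3) (r : ℕ)

/-- The divergences of the continuous piecewise polynomial vector fields of degree at most `r + 1`
vanishing on the boundary. -/
def divRange : Submodule ℝ (Fin 4 → P3) where
  carrier := {p | ∃ q : Fin 4 → VP3,
      (∀ i, degVle (q i) (r + 1)) ∧
      (∀ i j, i ≠ j → ∀ y ∈ intFace x i j, evalV (q i) y = evalV (q j) y) ∧
      (∀ i, ∀ y ∈ bdryFace x i, evalV (q i) y = 0) ∧
      (∀ i, pdiv (q i) = p i)}
  zero_mem' := ⟨0, fun i c => by simp, by simp, fun i y _ => by ext c; simp [evalV],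
    fun i => by simp [pdiv]⟩
  add_mem' := by
    rintro p p' ⟨q, hd, hi, hb, h⟩ ⟨q', hd', hi', hb', h'⟩
    have he : ∀ (u v : VP3) y, evalV (u + v) y = evalV u y + evalV v y := fun u v y => by
      ext c; simp [evalV]
    refine ⟨q + q', fun i c => (totalDegree_add _ _).trans (max_le (hd i c) (hd' i c)),
      fun i j hij y hy => ?_, fun i y hy => ?_, fun i => ?_⟩
    · simp [he, hi i j hij y hy, hi' i j hij y hy]
    · simp [he, hb i y hy, hb' i y hy]
    · simp [← h, ← h', pdiv, Finset.sum_add_distrib]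
  smul_mem' := by
    rintro a p ⟨q, hd, hi, hb, h⟩
    have he : ∀ (u : VP3) y, evalV (a • u) y = a • evalV u y := fun u y => by
      ext c; simp [evalV]
    refine ⟨a • q, fun i c => (totalDegree_smul_le _ _).trans (hd i c),
      fun i j hij y hy => ?_, fun i y hy => ?_, fun i => ?_⟩
    · simp [he, hi i j hij y hy]
    · simp [he, hb i y hy]
    · simp [← h, pdiv, Finset.smul_sum]

/-- The integral of a piecewise polynomial scalar field. -/
def integralMap : (Fin 4 → P3) →ₗ[ℝ] ℝ where
  toFun p := ∑ i, ∫ y in piece x i, eval y (p i)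
  map_add' p q := by
    rw [← Finset.sum_add_distrib]
    refine Finset.sum_congr rfl fun i _ => ?_
    have hint : ∀ q : P3, IntegrableOn (fun y => eval y q) (piece x i) := fun q =>
      (continuous_eval q).continuousOn.integrableOn_compact (isCompact_piece x i)
    simpa using integral_add (hint (p i)) (hint (q i))
  map_smul' a p := by
    simp [Finset.mul_sum, integral_const_mul]

theorem dirDeriv_mem_divRange (b : AffineBasis (Fin 4) ℝ V3) {n : ℕ} {A : P3}
    (h : A.totalDegree + n ≤ r) (v : V3) :
    (fun i => dirDeriv v (coordPoly b i ^ (n + 1) * A)) ∈ divRange b r := by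
  refine ⟨fun i c => C (v c) * (coordPoly b i ^ (n + 1) * A), fun i c => ?_,
    fun i j _ y hy => ?_, fun i y hy => ?_, fun i => pdiv_smul_const v _⟩
  · refine (totalDegree_mul _ _).trans ?_
    rw [totalDegree_C, zero_add]
    refine (totalDegree_mul _ _).trans ?_
    have h1 := totalDegree_pow (coordPoly b i) (n + 1)
    have h2 := Nat.mul_le_mul_left (n + 1) (totalDegree_coordPoly_le b i)
    omega
  · ext c
    simp [evalV, eval_coordPoly, coord_eq_of_mem_intFace b hy]
  · ext c
    simp [evalV, eval_coordPoly, coord_eq_zero_of_mem_bdryFace b hy]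

end divergence

end Alfeld

open MeasureTheory in
/-- every mean-zero piecewise polynomial scalar field on an Alfeld split is the
divergence of a continuous piecewise polynomial vector field vanishing on the boundary. -/
theorem statement2 (r : ℕ) (x : Fin 4 → V3) (hx : AffineIndependent ℝ x)
    (p : Fin 4 → P3) (hdeg : ∀ i, (p i).totalDegree ≤ r)
    (hmean : ∑ i, ∫ y in piece x i, eval y (p i) = 0) :
    ∃ q : Fin 4 → VP3,
      (∀ i, degVle (q i) (r + 1)) ∧
      (∀ i j, i ≠ j → ∀ y ∈ intFace x i j, evalV (q i) y = evalV (q j) y) ∧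
      (∀ i, ∀ y ∈ bdryFace x i, evalV (q i) y = 0) ∧
      (∀ i, pdiv (q i) = p i) := by
  obtain ⟨b, rfl⟩ : ∃ b : AffineBasis (Fin 4) ℝ V3, ⇑b = x :=
    ⟨⟨x, hx, hx.affineSpan_eq_top_iff_card_eq_finrank_add_one.2 (by simp)⟩, rfl⟩
  change p ∈ divRange b r
  let e : Fin 4 → P3 := Pi.single 0 (coordPoly b 0 ^ r)
  let B := divRange b r ⊓ (integralMap b).ker
  have hp : p ∈ B ⊔ ℝ ∙ e := by
    simpa using mem_of_dirDeriv_mem b (B ⊔ ℝ ∙ e) (s := 0) (d := r) (r := r)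
      (fun n A hA j k => Submodule.mem_sup_left
        ⟨dirDeriv_mem_divRange r b hA _, sum_integral_dirDeriv_eq_zero b n A _⟩)
      (Submodule.mem_sup_right (Submodule.mem_span_singleton_self e)) rfl p hdeg
  obtain ⟨u, hu, w, hw, rfl⟩ := Submodule.mem_sup.1 hp
  obtain ⟨a, rfl⟩ := Submodule.mem_span_singleton.1 hw
  have he : integralMap b e = ∫ y in piece b 0, eval y (coordPoly b 0 ^ r) := by
    change ∑ i, ∫ y in piece b i, eval y (e i) = _
    rw [Finset.sum_eq_single 0 (fun i _ hi => by simp [e, hi]) (by simp)]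
    simp [e]
  have h0 : integralMap b (u + a • e) = 0 := hmean
  rw [map_add, map_smul, LinearMap.mem_ker.1 hu.2, zero_add, smul_eq_mul, he] at h0
  have ha : a = 0 :=
    (mul_eq_zero.1 h0).resolve_right (integral_piece_coordPoly_pow_pos b 0 r).ne'
  simpa [ha] using hu.1
end
end
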